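/- Fix 1 < s < 2 and ε > 0. There exist c(ε, s) > 0 and δ₀(ε, s) > 0 such that the following holds for all 0 < δ < δ₀ and all N ≥ 1. Let E be a set of pairwise disjoint δ-balls contained in B_{ℂ²}(0,1) with (1/2)·N·δ^{−s} ≤ |E| ≤ 2·N·δ^{−s}, such that every ball of radius δ^{s/4} contains at most N of the δ-balls of E. Then the number of disjoint δ-balls needed to cover the difference set Δ(E) ⊆ ℂ is at least c(ε, s)·δ^{−s+ε}. -/

import Mathlib

open Metric
open scoped Classical

noncomputable section

/-- `ℂ²` with its Euclidean (Hermitian) metric. -/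
abbrev C2 := EuclideanSpace ℂ (Fin 2)

/-- The complex "distance" `Δ(p₁, p₂) = (x₁ - x₂)² + (y₁ - y₂)²` of two points of `ℂ²`. -/
def cDelta (p₁ p₂ : C2) : ℂ := (p₁ 0 - p₂ 0) ^ 2 + (p₁ 1 - p₂ 1) ^ 2

/-- The difference set `Δ(E)` of a collection of `δ`-balls with centres `E`. -/
def diffSet (E : Finset C2) (δ : ℝ) : Set ℂ :=
  {w | ∃ p₁ p₂ : C2, (∃ x ∈ E, p₁ ∈ closedBall x δ) ∧ (∃ x ∈ E, p₂ ∈ closedBall x δ) ∧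
    w = cDelta p₁ p₂}

namespace Aux
open MeasureTheory Real
open scoped RealInnerProductSpace ENNReal

section gauss
variable {V : Type*} [NormedAddCommGroup V] [InnerProductSpace ℝ V] [FiniteDimensional ℝ V]
  [MeasurableSpace V] [BorelSpace V]

lemma integrable_gauss_lin {β : ℝ} (hβ : 0 < β) (w : V) :
    Integrable (fun v : V => rexp (-β * ‖v‖ ^ 2 + ⟪w, v⟫)) := by
  have h := (GaussianFourier.integrable_cexp_neg_mul_sq_norm_add (V := V) (b := (β : ℂ))
    (by simpa using hβ) 1 w).norm
  refine h.congr (Filter.Eventually.of_forall fun v => ?_)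
  simp only [Complex.norm_exp]
  congr 1
  rw [show (-(β : ℂ) * (‖v‖ : ℂ) ^ 2 + 1 * (⟪w, v⟫ : ℝ)) = ((-β * ‖v‖ ^ 2 + ⟪w, v⟫ : ℝ) : ℂ) by
    push_cast; ring]
  exact Complex.ofReal_re _

lemma integral_gauss_lin {β : ℝ} (hβ : 0 < β) (w : V) :
    ∫ v : V, rexp (-β * ‖v‖ ^ 2 + ⟪w, v⟫) =
      (π / β) ^ (Module.finrank ℝ V / 2 : ℝ) * rexp (‖w‖ ^ 2 / (4 * β)) := by
  have h := GaussianFourier.integral_cexp_neg_mul_sq_norm_add (V := V) (b := (β : ℂ))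
    (by simpa using hβ) 1 w
  have e : (∫ v : V, Complex.exp (-(β : ℂ) * (‖v‖ : ℂ) ^ 2 + 1 * (⟪w, v⟫ : ℝ))) =
      ((∫ v : V, rexp (-β * ‖v‖ ^ 2 + ⟪w, v⟫) : ℝ) : ℂ) := by
    rw [← integral_complex_ofReal]
    congr 1; ext v
    push_cast; congr 1; ring
  rw [e] at h
  apply Complex.ofReal_injective
  rw [h]
  push_cast
  rw [Complex.ofReal_cpow (by positivity)]
  push_cast
  norm_num

lemma integrable_gauss_cos {β : ℝ} (hβ : 0 < β) (w : V) :
    Integrable (fun v : V => rexp (-β * ‖v‖ ^ 2) * cos ⟪w, v⟫) := by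
  have h := integrable_gauss_lin hβ (0 : V)
  refine h.mono' (by fun_prop) (Filter.Eventually.of_forall fun v => ?_)
  rw [norm_mul, Real.norm_eq_abs, Real.norm_eq_abs, abs_of_pos (exp_pos _)]
  simp only [inner_zero_left, add_zero]
  exact mul_le_of_le_one_right (exp_pos _).le (abs_cos_le_one _)

lemma integrable_gauss_sin {β : ℝ} (hβ : 0 < β) (w : V) :
    Integrable (fun v : V => rexp (-β * ‖v‖ ^ 2) * sin ⟪w, v⟫) := by
  have h := integrable_gauss_lin hβ (0 : V)
  refine h.mono' (by fun_prop) (Filter.Eventually.of_forall fun v => ?_)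
  rw [norm_mul, Real.norm_eq_abs, Real.norm_eq_abs, abs_of_pos (exp_pos _)]
  simp only [inner_zero_left, add_zero]
  exact mul_le_of_le_one_right (exp_pos _).le (abs_sin_le_one _)

lemma gauss_cexp {β : ℝ} (hβ : 0 < β) (w : V) :
    (∫ v : V, rexp (-β * ‖v‖ ^ 2) * cos ⟪w, v⟫ =
      (π / β) ^ (Module.finrank ℝ V / 2 : ℝ) * rexp (-‖w‖ ^ 2 / (4 * β))) := by
  have h := GaussianFourier.integral_cexp_neg_mul_sq_norm_add (V := V) (b := (β : ℂ))
    (by simpa using hβ) Complex.I w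
  have hi := GaussianFourier.integrable_cexp_neg_mul_sq_norm_add (V := V) (b := (β : ℂ))
    (by simpa using hβ) Complex.I w
  have h2 := congrArg Complex.re h
  rw [show (∫ v : V, Complex.exp (-(β : ℂ) * (‖v‖ : ℂ) ^ 2 + Complex.I * (⟪w, v⟫ : ℝ))).re =
    ∫ v : V, (Complex.exp (-(β : ℂ) * (‖v‖ : ℂ) ^ 2 + Complex.I * (⟪w, v⟫ : ℝ))).re from
      (integral_re hi).symm] at h2
  have e : ∀ v : V, (Complex.exp (-(β : ℂ) * (‖v‖ : ℂ) ^ 2 + Complex.I * (⟪w, v⟫ : ℝ))).re =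
      rexp (-β * ‖v‖ ^ 2) * cos ⟪w, v⟫ := by
    intro v
    rw [Complex.exp_re]
    have : (-(β : ℂ) * (‖v‖ : ℂ) ^ 2 + Complex.I * (⟪w, v⟫ : ℝ)) =
       ((-β * ‖v‖ ^ 2 : ℝ) : ℂ) + (⟪w, v⟫ : ℝ) * Complex.I := by push_cast; ring
    rw [this]
    simp only [Complex.add_re, Complex.add_im, Complex.ofReal_re, Complex.ofReal_im,
      Complex.re_ofReal_mul, Complex.im_ofReal_mul, Complex.I_re, Complex.I_im, mul_zero, mul_one,
      add_zero, zero_add]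
  simp only [e] at h2
  rw [h2]
  have : (π / (β : ℂ)) ^ (Module.finrank ℝ V / 2 : ℂ) *
      Complex.exp (Complex.I ^ 2 * ‖w‖ ^ 2 / (4 * β)) =
      (((π / β) ^ (Module.finrank ℝ V / 2 : ℝ) * rexp (-‖w‖ ^ 2 / (4 * β)) : ℝ) : ℂ) := by
    push_cast
    rw [Complex.ofReal_cpow (by positivity)]
    push_cast
    norm_num
  rw [this, Complex.ofReal_re]

lemma gauss_sin {β : ℝ} (w : V) :
    (∫ v : V, rexp (-β * ‖v‖ ^ 2) * sin ⟪w, v⟫ = 0) := by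
  have := integral_neg_eq_self (fun v : V => rexp (-β * ‖v‖ ^ 2) * sin ⟪w, v⟫) volume
  simp only [norm_neg, inner_neg_right, sin_neg, mul_neg, integral_neg] at this
  linarith

lemma gauss_cos_shift {β : ℝ} (hβ : 0 < β) (θ : ℝ) (w : V) :
    Integrable (fun v : V => rexp (-β * ‖v‖ ^ 2) * cos (θ + ⟪w, v⟫)) ∧
    (∫ v : V, rexp (-β * ‖v‖ ^ 2) * cos (θ + ⟪w, v⟫) =
      (π / β) ^ (Module.finrank ℝ V / 2 : ℝ) * rexp (-‖w‖ ^ 2 / (4 * β)) * cos θ) := by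
  have e : (fun v : V => rexp (-β * ‖v‖ ^ 2) * cos (θ + ⟪w, v⟫)) = fun v =>
     cos θ * (rexp (-β * ‖v‖ ^ 2) * cos ⟪w, v⟫) - sin θ * (rexp (-β * ‖v‖ ^ 2) * sin ⟪w, v⟫) := by
    ext v; rw [cos_add]; ring
  rw [e]
  have h1 := (integrable_gauss_cos hβ w).const_mul (cos θ)
  have h2 := (integrable_gauss_sin hβ w).const_mul (sin θ)
  refine ⟨h1.sub h2, ?_⟩
  rw [integral_sub h1 h2, integral_const_mul, integral_const_mul, gauss_sin, gauss_cexp hβ]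
  ring

lemma gauss_sin_shift {β : ℝ} (hβ : 0 < β) (θ : ℝ) (w : V) :
    Integrable (fun v : V => rexp (-β * ‖v‖ ^ 2) * sin (θ + ⟪w, v⟫)) ∧
    (∫ v : V, rexp (-β * ‖v‖ ^ 2) * sin (θ + ⟪w, v⟫) =
      (π / β) ^ (Module.finrank ℝ V / 2 : ℝ) * rexp (-‖w‖ ^ 2 / (4 * β)) * sin θ) := by
  have e : (fun v : V => rexp (-β * ‖v‖ ^ 2) * sin (θ + ⟪w, v⟫)) = fun v =>
     sin θ * (rexp (-β * ‖v‖ ^ 2) * cos ⟪w, v⟫) + cos θ * (rexp (-β * ‖v‖ ^ 2) * sin ⟪w, v⟫) := by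
    ext v; rw [sin_add]; ring
  rw [e]
  have h1 := (integrable_gauss_cos hβ w).const_mul (sin θ)
  have h2 := (integrable_gauss_sin hβ w).const_mul (cos θ)
  refine ⟨h1.add h2, ?_⟩
  rw [integral_add h1 h2, integral_const_mul, integral_const_mul, gauss_sin, gauss_cexp hβ]
  ring

/-- lintegral Gaussian -/
lemma lint_gauss {β : ℝ} (hβ : 0 < β) (w : V) :
    ∫⁻ v : V, ENNReal.ofReal (rexp (-β * ‖v - w‖ ^ 2)) =
      ENNReal.ofReal ((π / β) ^ (Module.finrank ℝ V / 2 : ℝ)) := by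
  rw [lintegral_sub_right_eq_self (fun v : V => ENNReal.ofReal (rexp (-β * ‖v‖ ^ 2))) w]
  have h := integrable_gauss_lin hβ (0 : V)
  have h2 := integral_gauss_lin hβ (0 : V)
  simp only [inner_zero_left, add_zero] at h h2
  rw [← ofReal_integral_eq_lintegral_ofReal h (Filter.Eventually.of_forall fun v => (exp_pos _).le), h2]
  simp
end gauss

lemma finrank_C2 : Module.finrank ℝ C2 = 4 := by
  rw [← Module.finrank_mul_finrank ℝ ℂ C2]; simp

end Aux

namespace Aux
open MeasureTheory Real
open scoped RealInnerProductSpace ENNReal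

/-- the symplectic form -/
def qf (a b : C2) : ℂ := a 0 * b 1 - a 1 * b 0

/-- the Gaussian cone kernel -/
def HH (α κ : ℝ) (a b : C2) : ℝ :=
  π / (α + κ * ‖b‖ ^ 2) * rexp (-(α * κ * ‖a‖ ^ 2 + κ ^ 2 * ‖qf a b‖ ^ 2) / (α + κ * ‖b‖ ^ 2))

def mm (a b : C2) : ℂ := a 0 * (starRingEnd ℂ) (b 0) + a 1 * (starRingEnd ℂ) (b 1)

lemma norm_add_smul (a b : C2) (l : ℂ) :
    ‖a + l • b‖ ^ 2 = ‖a‖ ^ 2 + ‖l‖ ^ 2 * ‖b‖ ^ 2 + 2 * ⟪mm a b, l⟫ := by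
  simp only [EuclideanSpace.norm_sq_eq, Fin.sum_univ_two, mm, Complex.inner, Complex.sq_norm,
    Complex.normSq_apply, PiLp.add_apply, PiLp.smul_apply, smul_eq_mul]
  simp
  ring

lemma norm_mm (a b : C2) : ‖mm a b‖ ^ 2 = ‖a‖ ^ 2 * ‖b‖ ^ 2 - ‖qf a b‖ ^ 2 := by
  simp only [EuclideanSpace.norm_sq_eq, Fin.sum_univ_two, mm, qf, Complex.sq_norm,
    Complex.normSq_apply]
  simp
  ring

lemma HH_int {α κ : ℝ} (a b : C2) (h : 0 < α + κ * ‖b‖ ^ 2) :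
    Integrable (fun l : ℂ => rexp (-α * ‖l‖ ^ 2 - κ * ‖a + l • b‖ ^ 2)) ∧
    ∫ l : ℂ, rexp (-α * ‖l‖ ^ 2 - κ * ‖a + l • b‖ ^ 2) = HH α κ a b := by
  have e : (fun l : ℂ => rexp (-α * ‖l‖ ^ 2 - κ * ‖a + l • b‖ ^ 2)) =
      fun l => rexp (-κ * ‖a‖ ^ 2) *
        rexp (-(α + κ * ‖b‖ ^ 2) * ‖l‖ ^ 2 + ⟪(-(2 * κ)) • mm a b, l⟫) := by
    ext l
    rw [← exp_add, norm_add_smul, inner_smul_left]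
    congr 1
    simp only [conj_trivial]
    ring
  rw [e]
  refine ⟨(integrable_gauss_lin h _).const_mul _, ?_⟩
  rw [integral_const_mul, integral_gauss_lin h]
  simp only [Complex.finrank_real_complex, Nat.cast_ofNat, ne_eq, OfNat.ofNat_ne_zero,
    not_false_eq_true, div_self, rpow_one]
  rw [HH, mul_left_comm, ← exp_add]
  congr 2
  rw [norm_smul, mul_pow, norm_mm]
  have := h.ne'
  rw [Real.norm_eq_abs, sq_abs]
  field_simp
  ring

lemma HH_nonneg {α κ : ℝ} (hα : 0 ≤ α) (hκ : 0 ≤ κ) (a b : C2) : 0 ≤ HH α κ a b := by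
  unfold HH; positivity

/-- squared modulus of an exponential sum -/
def NN {ι : Type*} (Z : Finset ι) (a θ : ι → ℝ) : ℝ :=
  (∑ i ∈ Z, a i * cos (θ i)) ^ 2 + (∑ i ∈ Z, a i * sin (θ i)) ^ 2

lemma NN_nonneg {ι : Type*} (Z : Finset ι) (a θ : ι → ℝ) : 0 ≤ NN Z a θ := by
  unfold NN; positivity

lemma NN_eq {ι : Type*} (Z : Finset ι) (a θ : ι → ℝ) :
    NN Z a θ = ∑ i ∈ Z, ∑ j ∈ Z, a i * a j * cos (θ i - θ j) := by
  unfold NN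
  rw [sq, sq, Finset.sum_mul_sum, Finset.sum_mul_sum, ← Finset.sum_add_distrib]
  refine Finset.sum_congr rfl fun i _ => ?_
  rw [← Finset.sum_add_distrib]
  refine Finset.sum_congr rfl fun j _ => ?_
  rw [cos_sub]; ring

/-- general: Gaussian-weighted lintegral of NN -/
lemma lint_NN {ι : Type*} {V : Type*} [NormedAddCommGroup V] [InnerProductSpace ℝ V]
    [FiniteDimensional ℝ V] [MeasurableSpace V] [BorelSpace V] {β : ℝ} (hβ : 0 < β)
    (Z : Finset ι) (a : ι → ℝ) (z : ι → V) :
    0 ≤ ∑ i ∈ Z, ∑ j ∈ Z, a i * a j *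
        ((π / β) ^ (Module.finrank ℝ V / 2 : ℝ) * rexp (-‖z i - z j‖ ^ 2 / (4 * β))) ∧
    ∫⁻ v : V, ENNReal.ofReal (rexp (-β * ‖v‖ ^ 2) * NN Z a (fun i => ⟪z i, v⟫)) =
      ENNReal.ofReal (∑ i ∈ Z, ∑ j ∈ Z, a i * a j *
        ((π / β) ^ (Module.finrank ℝ V / 2 : ℝ) * rexp (-‖z i - z j‖ ^ 2 / (4 * β)))) := by
  have e : (fun v : V => rexp (-β * ‖v‖ ^ 2) * NN Z a (fun i => ⟪z i, v⟫)) = fun v =>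
      ∑ i ∈ Z, ∑ j ∈ Z, a i * a j * (rexp (-β * ‖v‖ ^ 2) * cos ⟪z i - z j, v⟫) := by
    ext v
    rw [NN_eq, Finset.mul_sum]
    refine Finset.sum_congr rfl fun i _ => ?_
    rw [Finset.mul_sum]
    refine Finset.sum_congr rfl fun j _ => ?_
    rw [inner_sub_left]; ring
  have hi : ∀ i ∈ Z, Integrable (fun v : V =>
      ∑ j ∈ Z, a i * a j * (rexp (-β * ‖v‖ ^ 2) * cos ⟪z i - z j, v⟫)) := fun i _ =>
    integrable_finsetSum _ fun j _ => (integrable_gauss_cos hβ _).const_mul _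
  have hI : Integrable (fun v : V => rexp (-β * ‖v‖ ^ 2) * NN Z a (fun i => ⟪z i, v⟫)) := by
    rw [e]; exact integrable_finsetSum _ hi
  have hv : ∫ v : V, (rexp (-β * ‖v‖ ^ 2) * NN Z a (fun i => ⟪z i, v⟫)) =
      ∑ i ∈ Z, ∑ j ∈ Z, a i * a j *
        ((π / β) ^ (Module.finrank ℝ V / 2 : ℝ) * rexp (-‖z i - z j‖ ^ 2 / (4 * β))) := by
    rw [e, integral_finsetSum _ hi]
    refine Finset.sum_congr rfl fun i _ => ?_
    rw [integral_finsetSum _ fun j _ => (integrable_gauss_cos hβ _).const_mul _]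
    refine Finset.sum_congr rfl fun j _ => ?_
    rw [integral_const_mul, gauss_cexp hβ]
  have hnn : ∀ v : V, 0 ≤ (rexp (-β * ‖v‖ ^ 2) * NN Z a (fun i => ⟪z i, v⟫)) := fun v =>
    mul_nonneg (exp_pos _).le (NN_nonneg _ _ _)
  rw [← hv]
  exact ⟨integral_nonneg hnn,
    (ofReal_integral_eq_lintegral_ofReal hI (Filter.Eventually.of_forall hnn)).symm⟩

/-- cone average -/
def Psi {ι : Type*} (Z : Finset ι) (a : ι → ℝ) (x y : ι → C2) (α β : ℝ) : ℝ≥0∞ :=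
  ∫⁻ l : ℂ, ∫⁻ η : C2, ENNReal.ofReal (rexp (-α * ‖l‖ ^ 2 - β * ‖η‖ ^ 2) *
    NN Z a (fun i => ⟪x i + l • y i, η⟫))

def Ker {ι : Type*} (Z : Finset ι) (a : ι → ℝ) (x y : ι → C2) (α β : ℝ) : ℝ :=
  ∑ i ∈ Z, ∑ j ∈ Z, a i * a j * ((π / β) ^ 2 * HH α (1 / (4 * β)) (x i - x j) (y i - y j))

lemma Psi_eq {ι : Type*} (Z : Finset ι) (a : ι → ℝ) (x y : ι → C2) {α β : ℝ}
    (hα : 0 < α) (hβ : 0 < β) : Psi Z a x y α β = ENNReal.ofReal (Ker Z a x y α β) := by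
  have e1 : ∀ l : ℂ, ∫⁻ η : C2, ENNReal.ofReal (rexp (-α * ‖l‖ ^ 2 - β * ‖η‖ ^ 2) *
      NN Z a (fun i => ⟪x i + l • y i, η⟫)) = ENNReal.ofReal (∑ i ∈ Z, ∑ j ∈ Z, a i * a j *
        ((π / β) ^ 2 * rexp (-α * ‖l‖ ^ 2 -
          1 / (4 * β) * ‖(x i - x j) + l • (y i - y j)‖ ^ 2))) := by
    intro l
    obtain ⟨h0, h⟩ := lint_NN hβ Z a (fun i => x i + l • y i)
    have : ∀ η : C2, ENNReal.ofReal (rexp (-α * ‖l‖ ^ 2 - β * ‖η‖ ^ 2) *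
      NN Z a (fun i => ⟪x i + l • y i, η⟫)) = ENNReal.ofReal (rexp (-α * ‖l‖ ^ 2)) *
       ENNReal.ofReal (rexp (-β * ‖η‖ ^ 2) * NN Z a (fun i => ⟪x i + l • y i, η⟫)) := by
      intro η
      rw [← ENNReal.ofReal_mul (exp_pos _).le, ← mul_assoc, ← exp_add]
      congr 3; ring_nf
    simp_rw [this]
    rw [lintegral_const_mul' _ _ ENNReal.ofReal_ne_top, h, ← ENNReal.ofReal_mul (exp_pos _).le]
    congr 1
    rw [Finset.mul_sum]
    refine Finset.sum_congr rfl fun i _ => ?_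
    rw [Finset.mul_sum]
    refine Finset.sum_congr rfl fun j _ => ?_
    rw [finrank_C2]
    rw [show ((4 : ℕ) : ℝ) / 2 = ((2 : ℕ) : ℝ) by norm_num, rpow_natCast]
    rw [sub_eq_add_neg (-α * ‖l‖ ^ 2), exp_add]
    rw [show x i + l • y i - (x j + l • y j) = (x i - x j) + l • (y i - y j) by
      rw [smul_sub]; abel]
    rw [show -‖x i - x j + l • (y i - y j)‖ ^ 2 / (4 * β) =
      -(1 / (4 * β) * ‖x i - x j + l • (y i - y j)‖ ^ 2) by ring]
    ring
  unfold Psi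
  simp_rw [e1]
  have hp : ∀ b : C2, 0 < α + 1 / (4 * β) * ‖b‖ ^ 2 := fun b => by positivity
  have hij : ∀ i j, Integrable (fun l : ℂ => a i * a j *
        ((π / β) ^ 2 * rexp (-α * ‖l‖ ^ 2 -
          1 / (4 * β) * ‖(x i - x j) + l • (y i - y j)‖ ^ 2))) := fun i j =>
    ((HH_int _ _ (hp _)).1.const_mul _).const_mul _
  have hi : ∀ i, Integrable (fun l : ℂ => ∑ j ∈ Z, a i * a j *
        ((π / β) ^ 2 * rexp (-α * ‖l‖ ^ 2 -
          1 / (4 * β) * ‖(x i - x j) + l • (y i - y j)‖ ^ 2))) := fun i =>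
    integrable_finsetSum _ fun j _ => hij i j
  rw [← ofReal_integral_eq_lintegral_ofReal (integrable_finsetSum _ fun i _ => hi i)]
  · congr 1
    rw [integral_finsetSum _ fun i _ => hi i]
    refine Finset.sum_congr rfl fun i _ => ?_
    rw [integral_finsetSum _ fun j _ => hij i j]
    refine Finset.sum_congr rfl fun j _ => ?_
    rw [integral_const_mul, integral_const_mul, (HH_int _ _ (hp _)).2]
  · refine Filter.Eventually.of_forall fun l => ?_
    obtain ⟨h0, h⟩ := lint_NN hβ Z a (fun i => x i + l • y i)
    have := mul_nonneg (exp_pos (-α * ‖l‖ ^ 2)).le h0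
    refine le_of_le_of_eq this ?_
    simp only []
    rw [Finset.mul_sum]
    refine Finset.sum_congr rfl fun i _ => ?_
    rw [Finset.mul_sum]
    refine Finset.sum_congr rfl fun j _ => ?_
    rw [finrank_C2]
    rw [show ((4 : ℕ) : ℝ) / 2 = ((2 : ℕ) : ℝ) by norm_num, rpow_natCast]
    rw [sub_eq_add_neg (-α * ‖l‖ ^ 2), exp_add]
    rw [show x i + l • y i - (x j + l • y j) = (x i - x j) + l • (y i - y j) by
      rw [smul_sub]; abel]
    rw [show -‖x i - x j + l • (y i - y j)‖ ^ 2 / (4 * β) =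
      -(1 / (4 * β) * ‖x i - x j + l • (y i - y j)‖ ^ 2) by ring]
    ring

lemma Ker_nonneg {ι : Type*} (Z : Finset ι) (a : ι → ℝ) (ha : ∀ i, 0 ≤ a i) (x y : ι → C2)
    {α β : ℝ} (hα : 0 ≤ α) (hβ : 0 < β) : 0 ≤ Ker Z a x y α β := by
  unfold Ker
  refine Finset.sum_nonneg fun i _ => Finset.sum_nonneg fun j _ => ?_
  have := HH_nonneg hα (show 0 ≤ 1 / (4 * β) by positivity) (x i - x j) (y i - y j)
  have := ha i
  have := ha j
  positivity
end Aux

namespace Aux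
open MeasureTheory Real
open scoped RealInnerProductSpace ENNReal

def Sep {ι : Type*} (Z : Finset ι) (x y : ι → C2) : Prop :=
  ∀ i ∈ Z, ∀ j ∈ Z, i ≠ j → 1 ≤ ‖x i - x j‖ ^ 2 + ‖y i - y j‖ ^ 2

def wt {ι : Type*} (R : ℝ) (x y : ι → C2) (i : ι) : ℝ := rexp (-(‖x i‖ ^ 2 + ‖y i‖ ^ 2) / R ^ 2)

lemma wt_pos {ι : Type*} (R : ℝ) (x y : ι → C2) (i : ι) : 0 < wt R x y i := exp_pos _
lemma wt_le_one {ι : Type*} (R : ℝ) (x y : ι → C2) (i : ι) : wt R x y i ≤ 1 := by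
  unfold wt
  rw [exp_le_one_iff]
  rw [neg_div]
  have : 0 ≤ (‖x i‖ ^ 2 + ‖y i‖ ^ 2) / R ^ 2 := by positivity
  linarith

def V0 : ℝ≥0∞ := volume (ball (0 : C2) (1 / 4)) * volume (ball (0 : C2) (1 / 4))

lemma V0_ne_zero : V0 ≠ 0 := by
  unfold V0
  have : volume (ball (0 : C2) (1 / 4)) ≠ 0 := (measure_ball_pos _ _ (by norm_num)).ne'
  exact mul_ne_zero this this
lemma V0_ne_top : V0 ≠ ⊤ := by
  unfold V0
  exact ENNReal.mul_ne_top measure_ball_lt_top.ne measure_ball_lt_top.ne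

lemma pack {ι : Type*} (Z : Finset ι) (x y : ι → C2) (hs : Sep Z x y) (F : ι → ℝ≥0∞)
    (G : C2 → C2 → ℝ≥0∞) (hG : Measurable (fun p : C2 × C2 => G p.1 p.2))
    (h : ∀ i ∈ Z, ∀ w u : C2, ‖w - y i‖ ≤ 1 / 4 → ‖u - x i‖ ≤ 1 / 4 → F i ≤ G w u) :
    (∑ i ∈ Z, F i) * V0 ≤ ∫⁻ w, ∫⁻ u, G w u := by
  have e : ∫⁻ w, ∫⁻ u, G w u = ∫⁻ p : C2 × C2, G p.1 p.2 := by
    rw [Measure.volume_eq_prod]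
    exact (lintegral_prod (fun p : C2 × C2 => G p.1 p.2) hG.aemeasurable).symm
  rw [e]
  let B : ι → Set (C2 × C2) := fun i => ball (y i) (1 / 4) ×ˢ ball (x i) (1 / 4)
  have hB : ∀ i, volume (B i) = V0 := by
    intro i
    simp only [B, V0]
    rw [Measure.volume_eq_prod, Measure.prod_prod, Measure.addHaar_ball_center,
      Measure.addHaar_ball_center volume (x i)]
  have hm : ∀ i, MeasurableSet (B i) := fun i => measurableSet_ball.prod measurableSet_ball
  have hd : Set.PairwiseDisjoint (Z : Set ι) B := by
    intro i hi j hj hij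
    rw [Function.onFun, Set.disjoint_left]
    rintro ⟨w, u⟩ h1 h2
    simp only [B, Set.mem_prod, mem_ball, dist_eq_norm] at h1 h2
    have h3 := hs i hi j hj hij
    have a1 : ‖x i - x j‖ ≤ ‖u - x j‖ + ‖u - x i‖ := by
      have := norm_sub_le (u - x j) (u - x i)
      simpa using this
    have a2 : ‖y i - y j‖ ≤ ‖w - y j‖ + ‖w - y i‖ := by
      have := norm_sub_le (w - y j) (w - y i)
      simpa using this
    have b1 : ‖x i - x j‖ ^ 2 ≤ (1 / 2) ^ 2 := by
      apply pow_le_pow_left₀ (norm_nonneg _); linarith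
    have b2 : ‖y i - y j‖ ^ 2 ≤ (1 / 2) ^ 2 := by
      apply pow_le_pow_left₀ (norm_nonneg _); linarith
    linarith
  calc (∑ i ∈ Z, F i) * V0 = ∑ i ∈ Z, ∫⁻ p in B i, F i := by
        rw [Finset.sum_mul]
        refine Finset.sum_congr rfl fun i _ => ?_
        rw [lintegral_const, Measure.restrict_apply_univ, hB]
    _ ≤ ∑ i ∈ Z, ∫⁻ p in B i, G p.1 p.2 := by
        refine Finset.sum_le_sum fun i hi => ?_
        refine setLIntegral_mono_ae hG.aemeasurable (Filter.Eventually.of_forall fun p hp => ?_)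
        simp only [B, Set.mem_prod, mem_ball, dist_eq_norm] at hp
        exact h i hi _ _ hp.1.le hp.2.le
    _ = ∫⁻ p in ⋃ i ∈ Z, B i, G p.1 p.2 := (lintegral_biUnion_finset hd (fun i _ => hm i) _).symm
    _ ≤ ∫⁻ p : C2 × C2, G p.1 p.2 := setLIntegral_le_lintegral _ _

lemma nsq_le {V : Type*} [NormedAddCommGroup V] (u v : V) :
    ‖u‖ ^ 2 ≤ 2 * ‖v‖ ^ 2 + 2 * ‖u - v‖ ^ 2 := by
  have h : ‖u‖ ≤ ‖v‖ + ‖u - v‖ := by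
    have := norm_add_le v (u - v); simpa using this
  nlinarith [norm_nonneg u, norm_nonneg v, norm_nonneg (u - v), sq_nonneg (‖v‖ - ‖u - v‖)]

lemma lint_gauss_C2 {β : ℝ} (hβ : 0 < β) (w : C2) :
    ∫⁻ v : C2, ENNReal.ofReal (rexp (-β * ‖v - w‖ ^ 2)) = ENNReal.ofReal ((π / β) ^ 2) := by
  rw [lint_gauss hβ, finrank_C2]
  rw [show ((4 : ℕ) : ℝ) / 2 = ((2 : ℕ) : ℝ) by norm_num, rpow_natCast]

lemma lint_gauss_C {β : ℝ} (hβ : 0 < β) :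
    ∫⁻ v : ℂ, ENNReal.ofReal (rexp (-β * ‖v‖ ^ 2)) = ENNReal.ofReal (π / β) := by
  have := lint_gauss hβ (0 : ℂ)
  simp only [sub_zero] at this
  rw [this]; simp

/-- weights sum -/
lemma sum_wt : ∃ C : ℝ, 0 < C ∧ ∀ {ι : Type} (Z : Finset ι) (x y : ι → C2), Sep Z x y →
    ∀ R : ℝ, 1 ≤ R → ∑ i ∈ Z, wt R x y i ≤ C * R ^ 8 := by
  refine ⟨rexp (1 / 8) * (2 * π) ^ 4 / V0.toReal, ?_, ?_⟩
  · have := ENNReal.toReal_pos V0_ne_zero V0_ne_top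
    positivity
  intro ι Z x y hs R hR
  have hR0 : 0 < R := by linarith
  have hβ : 0 < 1 / (2 * R ^ 2) := by positivity
  have h := pack Z x y hs (fun i => ENNReal.ofReal (wt R x y i))
    (fun w u => ENNReal.ofReal (rexp (1 / 8)) * (ENNReal.ofReal (rexp (-(1 / (2 * R ^ 2)) * ‖w - 0‖ ^ 2)) *
      ENNReal.ofReal (rexp (-(1 / (2 * R ^ 2)) * ‖u - 0‖ ^ 2)))) (by fun_prop) (by
      intro i _ w u hw hu
      rw [← ENNReal.ofReal_mul (exp_pos _).le, ← ENNReal.ofReal_mul (exp_pos _).le, ← exp_add,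
        ← exp_add]
      apply ENNReal.ofReal_le_ofReal
      unfold wt
      apply exp_le_exp.2
      have h1 := nsq_le w (y i)
      have h2 := nsq_le u (x i)
      have h3 : ‖w - y i‖ ^ 2 ≤ (1 / 4) ^ 2 := pow_le_pow_left₀ (norm_nonneg _) hw 2
      have h4 : ‖u - x i‖ ^ 2 ≤ (1 / 4) ^ 2 := pow_le_pow_left₀ (norm_nonneg _) hu 2
      simp only [sub_zero]
      rw [div_le_iff₀ (by positivity)]
      have : (1 / 8 + (-(1 / (2 * R ^ 2)) * ‖w‖ ^ 2 + -(1 / (2 * R ^ 2)) * ‖u‖ ^ 2)) * R ^ 2 =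
        1 / 8 * R ^ 2 - ‖w‖ ^ 2 / 2 - ‖u‖ ^ 2 / 2 := by field_simp; ring
      rw [this]
      nlinarith)
  rw [lintegral_congr (g := fun w => ENNReal.ofReal (rexp (1 / 8)) *
    (ENNReal.ofReal (rexp (-(1 / (2 * R ^ 2)) * ‖w - 0‖ ^ 2)) *
      ENNReal.ofReal ((π / (1 / (2 * R ^ 2))) ^ 2)))] at h
  rotate_left
  · intro w
    rw [lintegral_const_mul' _ _ ENNReal.ofReal_ne_top,
      lintegral_const_mul' _ _ ENNReal.ofReal_ne_top, lint_gauss_C2 hβ]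
  rw [lintegral_const_mul' _ _ ENNReal.ofReal_ne_top,
      lintegral_mul_const' _ _ ENNReal.ofReal_ne_top, lint_gauss_C2 hβ] at h
  rw [← ENNReal.ofReal_mul (by positivity), ← ENNReal.ofReal_mul (by positivity),
    ← ENNReal.ofReal_sum_of_nonneg (fun i _ => (wt_pos R x y i).le),
    ← ENNReal.ofReal_toReal V0_ne_top, ← ENNReal.ofReal_mul
      (Finset.sum_nonneg (fun i _ => (wt_pos R x y i).le))] at h
  rw [ENNReal.ofReal_le_ofReal_iff (by positivity)] at h
  have hv := ENNReal.toReal_pos V0_ne_zero V0_ne_top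
  rw [div_mul_eq_mul_div, le_div_iff₀ hv]
  refine h.trans (le_of_eq ?_)
  field_simp
  

/-- low-frequency row bound -/
lemma low_row : ∃ C : ℝ, 0 < C ∧ ∀ {ι : Type} (Z : Finset ι) (x y : ι → C2), Sep Z x y →
    ∀ R κ : ℝ, 1 ≤ R → 1 / 4 ≤ κ → κ ≤ 1 → ∀ p1 p2 : C2,
    ∑ j ∈ Z, wt R x y j * HH 1 κ (p1 - x j) (p2 - y j) ≤ C * R ^ 4 := by
  refine ⟨rexp (3 / 16) * (8 * π / 7) * (8 * π) ^ 2 * (2 * π) ^ 2 / V0.toReal, ?_, ?_⟩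
  · have := ENNReal.toReal_pos V0_ne_zero V0_ne_top
    positivity
  intro ι Z x y hs R κ hR hκ1 hκ2 p1 p2
  have hR0 : 0 < R := by linarith
  have hv := ENNReal.toReal_pos V0_ne_zero V0_ne_top
  have hβ : 0 < 1 / (2 * R ^ 2) := by positivity
  have hp : ∀ b : C2, 0 < 1 + κ * ‖b‖ ^ 2 := fun b => by positivity
  have hterm : ∀ j, ENNReal.ofReal (wt R x y j * HH 1 κ (p1 - x j) (p2 - y j)) =
      ∫⁻ l : ℂ, ENNReal.ofReal (wt R x y j *
        rexp (-1 * ‖l‖ ^ 2 - κ * ‖(p1 - x j) + l • (p2 - y j)‖ ^ 2)) := by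
    intro j
    obtain ⟨h1, h2⟩ := HH_int (p1 - x j) (p2 - y j) (hp _)
    rw [← h2, ← integral_const_mul]
    exact ofReal_integral_eq_lintegral_ofReal (h1.const_mul _)
      (Filter.Eventually.of_forall fun l => mul_nonneg (wt_pos _ _ _ _).le (exp_pos _).le)
  have hl : ∀ l : ℂ, (∑ j ∈ Z, ENNReal.ofReal (wt R x y j *
        rexp (-1 * ‖l‖ ^ 2 - κ * ‖(p1 - x j) + l • (p2 - y j)‖ ^ 2))) * V0 ≤
        ENNReal.ofReal (rexp (3 / 16) * ((8 * π) ^ 2 * ((2 * π) ^ 2 * R ^ 4))) *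
          ENNReal.ofReal (rexp (-(7 / 8) * ‖l‖ ^ 2)) := by
    intro l
    have h := pack Z x y hs (fun j => ENNReal.ofReal (wt R x y j *
        rexp (-1 * ‖l‖ ^ 2 - κ * ‖(p1 - x j) + l • (p2 - y j)‖ ^ 2)))
      (fun w u => ENNReal.ofReal (rexp (3 / 16 - 7 / 8 * ‖l‖ ^ 2)) *
       (ENNReal.ofReal (rexp (-(1 / (2 * R ^ 2)) * ‖w - 0‖ ^ 2)) *
        ENNReal.ofReal (rexp (-(1 / 8) * ‖u - (p1 + l • (p2 - w))‖ ^ 2)))) (by fun_prop) (by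
      intro j _ w u hw hu
      rw [← ENNReal.ofReal_mul (exp_pos _).le, ← ENNReal.ofReal_mul (exp_pos _).le, ← exp_add,
        ← exp_add]
      apply ENNReal.ofReal_le_ofReal
      unfold wt
      rw [← exp_add]
      apply exp_le_exp.2
      have h1 := nsq_le w (y j)
      have h3 : ‖w - y j‖ ^ 2 ≤ (1 / 4) ^ 2 := pow_le_pow_left₀ (norm_nonneg _) hw 2
      have h5 := nsq_le (u - (p1 + l • (p2 - w))) (-((p1 - x j) + l • (p2 - y j)))
      rw [norm_neg] at h5
      have h6 : ‖u - (p1 + l • (p2 - w)) - -((p1 - x j) + l • (p2 - y j))‖ ^ 2 ≤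
          (1 + ‖l‖ ^ 2) / 8 := by
        have e : u - (p1 + l • (p2 - w)) - -((p1 - x j) + l • (p2 - y j)) =
          (u - x j) + l • (w - y j) := by
          simp only [smul_sub]; abel
        rw [e]
        have := (norm_add_le (u - x j) (l • (w - y j)))
        rw [norm_smul] at this
        have h7 : ‖l‖ * ‖w - y j‖ ≤ ‖l‖ * (1 / 4) := mul_le_mul_of_nonneg_left hw (norm_nonneg _)
        have h8 : ‖(u - x j) + l • (w - y j)‖ ^ 2 ≤ (1 / 4 + ‖l‖ * (1 / 4)) ^ 2 :=
          pow_le_pow_left₀ (norm_nonneg _) (by linarith) 2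
        nlinarith [sq_nonneg (1 - ‖l‖)]
      simp only [sub_zero]
      set A := ‖(p1 - x j) + l • (p2 - y j)‖ ^ 2
      set A' := ‖u - (p1 + l • (p2 - w))‖ ^ 2
      have h9 : (-(‖x j‖ ^ 2 + ‖y j‖ ^ 2) / R ^ 2) ≤ 1 / 16 + -(1 / (2 * R ^ 2)) * ‖w‖ ^ 2 := by
        rw [div_le_iff₀ (by positivity)]
        have : (1 / 16 + -(1 / (2 * R ^ 2)) * ‖w‖ ^ 2) * R ^ 2 = 1 / 16 * R ^ 2 - ‖w‖ ^ 2 / 2 := by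
          field_simp; ring
        rw [this]
        nlinarith [sq_nonneg (‖x j‖)]
      have h10 : κ * A ≥ 1 / 4 * A := mul_le_mul_of_nonneg_right hκ1 (by positivity)
      nlinarith)
    refine h.trans (le_of_eq ?_)
    rw [lintegral_congr (g := fun w => ENNReal.ofReal (rexp (3 / 16 - 7 / 8 * ‖l‖ ^ 2)) *
      (ENNReal.ofReal (rexp (-(1 / (2 * R ^ 2)) * ‖w - 0‖ ^ 2)) *
        ENNReal.ofReal ((π / (1 / 8)) ^ 2)))]
    rotate_left
    · intro w
      rw [lintegral_const_mul' _ _ ENNReal.ofReal_ne_top,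
        lintegral_const_mul' _ _ ENNReal.ofReal_ne_top, lint_gauss_C2 (by norm_num)]
    rw [lintegral_const_mul' _ _ ENNReal.ofReal_ne_top,
        lintegral_mul_const' _ _ ENNReal.ofReal_ne_top, lint_gauss_C2 hβ]
    rw [← ENNReal.ofReal_mul (by positivity), ← ENNReal.ofReal_mul (by positivity),
      ← ENNReal.ofReal_mul (by positivity)]
    congr 1
    rw [show 3 / 16 - 7 / 8 * ‖l‖ ^ 2 = 3 / 16 + -(7 / 8) * ‖l‖ ^ 2 by ring, exp_add]
    field_simp
  have hnn : ∀ j ∈ Z, 0 ≤ wt R x y j * HH 1 κ (p1 - x j) (p2 - y j) := fun j _ =>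
    mul_nonneg (wt_pos _ _ _ _).le (HH_nonneg (by norm_num) (by linarith) _ _)
  have key : ENNReal.ofReal ((∑ j ∈ Z, wt R x y j * HH 1 κ (p1 - x j) (p2 - y j)) * V0.toReal) ≤
      ENNReal.ofReal (rexp (3 / 16) * ((8 * π) ^ 2 * ((2 * π) ^ 2 * R ^ 4)) * (π / (7 / 8))) := by
    rw [ENNReal.ofReal_mul (Finset.sum_nonneg hnn), ENNReal.ofReal_sum_of_nonneg hnn,
      ENNReal.ofReal_toReal V0_ne_top]
    simp_rw [hterm]
    rw [← lintegral_finsetSum _ (fun j _ => by fun_prop), ← lintegral_mul_const' _ _ V0_ne_top]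
    refine (lintegral_mono hl).trans (le_of_eq ?_)
    rw [lintegral_const_mul' _ _ ENNReal.ofReal_ne_top, lint_gauss_C (by norm_num),
      ← ENNReal.ofReal_mul (by positivity)]
  rw [ENNReal.ofReal_le_ofReal_iff (by positivity)] at key
  rw [div_mul_eq_mul_div, le_div_iff₀ hv]
  refine key.trans (le_of_eq ?_)
  ring

lemma low_part : ∃ C : ℝ, 0 < C ∧ ∀ {ι : Type} (Z : Finset ι) (x y : ι → C2), Sep Z x y →
    ∀ R k : ℝ, 1 ≤ R → 1 ≤ k → k ≤ 2 → Ker Z (wt R x y) x y 1 (1 / k ^ 2) ≤ C * R ^ 12 := by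
  obtain ⟨C1, hC1, h1⟩ := sum_wt
  obtain ⟨D2, hD2, h2⟩ := low_row
  refine ⟨(4 * π) ^ 2 * C1 * D2, by positivity, ?_⟩
  intro ι Z x y hs R k hR hk1 hk2
  have hR0 : 0 < R := by linarith
  have hk0 : 0 < k := by linarith
  unfold Ker
  have hk : 1 / (4 * (1 / k ^ 2)) = k ^ 2 / 4 := by field_simp
  rw [hk]
  have hpk : π / (1 / k ^ 2) = π * k ^ 2 := by field_simp
  rw [hpk]
  have hb : (π * k ^ 2) ^ 2 ≤ (4 * π) ^ 2 := by
    apply pow_le_pow_left₀ (by positivity)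
    have : k ^ 2 ≤ 4 := by nlinarith
    nlinarith [pi_pos]
  calc ∑ i ∈ Z, ∑ j ∈ Z, wt R x y i * wt R x y j * ((π * k ^ 2) ^ 2 *
        HH 1 (k ^ 2 / 4) (x i - x j) (y i - y j))
      = ∑ i ∈ Z, (π * k ^ 2) ^ 2 * (wt R x y i * ∑ j ∈ Z, wt R x y j *
        HH 1 (k ^ 2 / 4) (x i - x j) (y i - y j)) := by
        refine Finset.sum_congr rfl fun i _ => ?_
        rw [Finset.mul_sum, Finset.mul_sum]
        refine Finset.sum_congr rfl fun j _ => ?_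
        ring
    _ ≤ ∑ i ∈ Z, (4 * π) ^ 2 * (wt R x y i * (D2 * R ^ 4)) := by
        refine Finset.sum_le_sum fun i _ => ?_
        have h3 := h2 Z x y hs R (k ^ 2 / 4) hR (by nlinarith) (by nlinarith) (x i) (y i)
        have h4 := wt_pos R x y i
        have : 0 ≤ wt R x y i * (D2 * R ^ 4) := by positivity
        refine (mul_le_mul_of_nonneg_left (mul_le_mul_of_nonneg_left h3 h4.le)
          (by positivity)).trans (mul_le_mul_of_nonneg_right hb this)
    _ = (4 * π) ^ 2 * (D2 * R ^ 4) * ∑ i ∈ Z, wt R x y i := by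
        rw [Finset.mul_sum]
        refine Finset.sum_congr rfl fun i _ => ?_
        ring
    _ ≤ (4 * π) ^ 2 * (D2 * R ^ 4) * (C1 * R ^ 8) :=
        mul_le_mul_of_nonneg_left (h1 Z x y hs R hR) (by positivity)
    _ = _ := by ring
end Aux

namespace Aux
open MeasureTheory Real
open scoped RealInnerProductSpace ENNReal

abbrev P8 := WithLp 2 (C2 × C2)

lemma finrank_P8 : Module.finrank ℝ P8 = 8 := by
  rw [LinearEquiv.finrank_eq (WithLp.linearEquiv 2 ℝ (C2 × C2)), Module.finrank_prod,
    ← Module.finrank_mul_finrank ℝ ℂ C2]; simp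

lemma pow_P8 (t : ℝ) : t ^ (Module.finrank ℝ P8 / 2 : ℝ) = t ^ 4 := by
  rw [finrank_P8, show ((8 : ℕ) : ℝ) / 2 = ((4 : ℕ) : ℝ) by norm_num, rpow_natCast]

lemma cont_NN {ι : Type*} {X : Type*} [TopologicalSpace X] (Z : Finset ι) (A Θ : ι → X → ℝ)
    (hA : ∀ i, Continuous (A i)) (hΘ : ∀ i, Continuous (Θ i)) :
    Continuous (fun p => NN Z (fun i => A i p) (fun i => Θ i p)) := by
  unfold NN
  refine ((continuous_finsetSum _ fun i _ => ?_).pow 2).add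
    ((continuous_finsetSum _ fun i _ => ?_).pow 2)
  · exact (hA i).mul (continuous_cos.comp (hΘ i))
  · exact (hA i).mul (continuous_sin.comp (hΘ i))

/-- the point of `P8` attached to a pair -/
def pt (a b : C2) : P8 := WithLp.toLp 2 (a, b)

lemma pt_norm (a b : C2) : ‖pt a b‖ ^ 2 = ‖a‖ ^ 2 + ‖b‖ ^ 2 := by
  simp [pt, WithLp.prod_norm_sq_eq_of_L2]

/-- the cone map -/
def cone (p : ℂ × C2) : P8 := pt p.2 ((starRingEnd ℂ) p.1 • p.2)

lemma cont_cone : Continuous cone := by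
  unfold cone pt
  refine (WithLp.prod_continuous_toLp 2 C2 C2).comp ?_
  refine continuous_snd.prodMk ?_
  exact (Complex.continuous_conj.comp continuous_fst).smul continuous_snd

lemma inner_conj_smul (l : ℂ) (y η : C2) : ⟪y, (starRingEnd ℂ) l • η⟫ = ⟪l • y, η⟫ := by
  simp [PiLp.inner_apply, Fin.sum_univ_two, Complex.inner]; ring

lemma inner_cone (x y : C2) (p : ℂ × C2) : ⟪pt x y, cone p⟫ = ⟪x + p.1 • y, p.2⟫ := by
  simp only [cone, pt, WithLp.prod_inner_apply]
  rw [inner_conj_smul, inner_add_left]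

lemma Psi_prod {ι : Type*} (Z : Finset ι) (a : ι → ℝ) (x y : ι → C2) (α β : ℝ) :
    Psi Z a x y α β = ∫⁻ p : ℂ × C2, ENNReal.ofReal (rexp (-α * ‖p.1‖ ^ 2 - β * ‖p.2‖ ^ 2) *
    NN Z a (fun i => ⟪pt (x i) (y i), cone p⟫)) := by
  simp_rw [inner_cone]
  unfold Psi
  rw [Measure.volume_eq_prod]
  rw [lintegral_prod]
  refine Measurable.aemeasurable ?_
  refine (Continuous.measurable ?_).ennreal_ofReal
  refine Continuous.mul (by fun_prop) ?_
  exact cont_NN Z _ _ (fun i => continuous_const) (fun i => by fun_prop)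

/-- high frequency part -/
def TT {ι : Type*} (Z : Finset ι) (a : ι → ℝ) (x y : ι → C2) (k : ℝ) : ℝ≥0∞ :=
  ∫⁻ p : ℂ × C2, ENNReal.ofReal (rexp (-‖p.1‖ ^ 2) * (‖p.2‖ ^ 2 / k ^ 2 * rexp (-‖p.2‖ ^ 2 / k ^ 2)) *
    NN Z a (fun i => ⟪pt (x i) (y i), cone p⟫))

lemma telescope {ι : Type*} (Z : Finset ι) (a : ι → ℝ) (x y : ι → C2) (k : ℝ) (hk : 0 < k) :
    Psi Z a x y 1 (1 / (2 * k) ^ 2) ≤ Psi Z a x y 1 (1 / k ^ 2) + 3 * TT Z a x y (2 * k) := by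
  rw [Psi_prod, Psi_prod, TT, ← lintegral_const_mul' _ _ (by norm_num), ← lintegral_add_left]
  swap
  · refine (Continuous.measurable ?_).ennreal_ofReal
    refine Continuous.mul (by fun_prop) ?_
    exact cont_NN Z _ _ (fun i => continuous_const) (fun i => by have := cont_cone; fun_prop)
  refine lintegral_mono fun p => ?_
  simp only []
  set n := NN Z a (fun i => ⟪pt (x i) (y i), cone p⟫)
  have hn : 0 ≤ n := NN_nonneg _ _ _
  rw [show (3 : ℝ≥0∞) = ENNReal.ofReal 3 by simp, ← ENNReal.ofReal_mul (by norm_num),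
    ← ENNReal.ofReal_add (by positivity) (by positivity)]
  apply ENNReal.ofReal_le_ofReal
  set t := ‖p.2‖ ^ 2 / (2 * k) ^ 2 with ht
  have e1 : -1 * ‖p.1‖ ^ 2 - 1 / (2 * k) ^ 2 * ‖p.2‖ ^ 2 = -‖p.1‖ ^ 2 + -t := by rw [ht]; ring
  have e2 : -1 * ‖p.1‖ ^ 2 - 1 / k ^ 2 * ‖p.2‖ ^ 2 = -‖p.1‖ ^ 2 + (-t + -(3 * t)) := by
    rw [ht]; field_simp; ring
  have e3 : -‖p.2‖ ^ 2 / (2 * k) ^ 2 = -t := by rw [ht]; ring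
  rw [e1, e2, e3, exp_add, exp_add, exp_add]
  have h := add_one_le_exp (-(3 * t))
  have h2 : 0 ≤ rexp (-‖p.1‖ ^ 2) * rexp (-t) * n := by positivity
  nlinarith

lemma jensen {V : Type*} [MeasurableSpace V] {μ : Measure V} (ρ f : V → ℝ) (hρ : ∀ v, 0 ≤ ρ v)
    (hi : Integrable ρ μ) (h1 : ∫ v, ρ v ∂μ = 1) (hf1 : Integrable (fun v => ρ v * f v) μ)
    (hf2 : Integrable (fun v => ρ v * f v ^ 2) μ) :
    (∫ v, ρ v * f v ∂μ) ^ 2 ≤ ∫ v, ρ v * f v ^ 2 ∂μ := by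
  set m := ∫ v, ρ v * f v ∂μ with hm
  have h0 : 0 ≤ ∫ v, ρ v * (f v - m) ^ 2 ∂μ := integral_nonneg fun v =>
    mul_nonneg (hρ v) (sq_nonneg _)
  have e : ∫ v, ρ v * (f v - m) ^ 2 ∂μ = ∫ v, (ρ v * f v ^ 2 - 2 * m * (ρ v * f v) + m ^ 2 * ρ v) ∂μ := by
    congr 1; ext v; ring
  have hs : Integrable (fun v => ρ v * f v ^ 2 - 2 * m * (ρ v * f v)) μ :=
    hf2.sub (hf1.const_mul _)
  rw [e, integral_add hs (hi.const_mul _),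
    integral_sub hf2 (hf1.const_mul _), integral_const_mul, integral_const_mul, h1, ← hm] at h0
  nlinarith

/-- convolution bound -/
lemma conv_bound {ι : Type*} (Z : Finset ι) (z : ι → P8) (θ : ι → ℝ) (R : ℝ) (hR : 0 < R) :
    ENNReal.ofReal (NN Z (fun i => rexp (-‖z i‖ ^ 2 / R ^ 2)) θ) ≤
    ∫⁻ v : P8, ENNReal.ofReal (((R ^ 2 / 2) / π) ^ 4 * rexp (-(R ^ 2 / 2) * ‖v‖ ^ 2) *
      NN Z (fun i => rexp (-‖z i‖ ^ 2 / (2 * R ^ 2))) (fun i => θ i + ⟪z i, v⟫)) := by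
  set β := R ^ 2 / 2 with hβd
  have hβ : 0 < β := by positivity
  set b : ι → ℝ := fun i => rexp (-‖z i‖ ^ 2 / (2 * R ^ 2)) with hb
  set ρ : P8 → ℝ := fun v => (β / π) ^ 4 * rexp (-β * ‖v‖ ^ 2) with hρ
  have hρ0 : ∀ v, 0 ≤ ρ v := fun v => by simp only [hρ]; positivity
  have hgi : Integrable (fun v : P8 => rexp (-β * ‖v‖ ^ 2)) := by
    have := integrable_gauss_lin hβ (0 : P8)
    simpa using this
  have hρi : Integrable ρ := hgi.const_mul _
  have hρ1 : ∫ v, ρ v = 1 := by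
    have := integral_gauss_lin hβ (0 : P8)
    simp only [inner_zero_left, add_zero] at this
    simp only [hρ]
    rw [integral_const_mul, this, pow_P8]
    simp
    field_simp
  have hbd : ∀ (g : P8 → ℝ) (M : ℝ), Continuous g → (∀ v, |g v| ≤ M) → Integrable (fun v => ρ v * g v) := by
    intro g M hg hM
    refine (hρi.mul_const M).mono' (by
      refine Continuous.aestronglyMeasurable ?_
      simp only [hρ]; fun_prop) (Filter.Eventually.of_forall fun v => ?_)
    rw [norm_mul, Real.norm_eq_abs, Real.norm_eq_abs, abs_of_nonneg (hρ0 v)]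
    exact mul_le_mul_of_nonneg_left (hM v) (hρ0 v)
  set f : P8 → ℝ := fun v => ∑ i ∈ Z, b i * cos (θ i + ⟪z i, v⟫) with hf
  set g : P8 → ℝ := fun v => ∑ i ∈ Z, b i * sin (θ i + ⟪z i, v⟫) with hg
  have hb0 : ∀ i, 0 ≤ b i := fun i => (exp_pos _).le
  have hfM : ∀ v, |f v| ≤ ∑ i ∈ Z, b i := fun v => (Finset.abs_sum_le_sum_abs _ _).trans
    (Finset.sum_le_sum fun i _ => by
      rw [abs_mul, abs_of_nonneg (hb0 i)]
      exact mul_le_of_le_one_right (hb0 i) (abs_cos_le_one _))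
  have hgM : ∀ v, |g v| ≤ ∑ i ∈ Z, b i := fun v => (Finset.abs_sum_le_sum_abs _ _).trans
    (Finset.sum_le_sum fun i _ => by
      rw [abs_mul, abs_of_nonneg (hb0 i)]
      exact mul_le_of_le_one_right (hb0 i) (abs_sin_le_one _))
  have hfc : Continuous f := continuous_finsetSum _ fun i _ => by fun_prop
  have hgc : Continuous g := continuous_finsetSum _ fun i _ => by fun_prop
  have hf1 := hbd f _ hfc hfM
  have hg1 := hbd g _ hgc hgM
  have hf2 := hbd (fun v => f v ^ 2) ((∑ i ∈ Z, b i) ^ 2) (hfc.pow 2) (fun v => by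
    rw [abs_pow]; exact pow_le_pow_left₀ (abs_nonneg _) (hfM v) 2)
  have hg2 := hbd (fun v => g v ^ 2) ((∑ i ∈ Z, b i) ^ 2) (hgc.pow 2) (fun v => by
    rw [abs_pow]; exact pow_le_pow_left₀ (abs_nonneg _) (hgM v) 2)
  have ea : ∀ i, b i * (rexp (-‖z i‖ ^ 2 / (4 * β))) = rexp (-‖z i‖ ^ 2 / R ^ 2) := by
    intro i
    simp only [hb]
    rw [← exp_add]; congr 1; rw [hβd]; field_simp; ring
  have vf : ∫ v, ρ v * f v = ∑ i ∈ Z, rexp (-‖z i‖ ^ 2 / R ^ 2) * cos (θ i) := by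
    have : ∀ v, ρ v * f v = ∑ i ∈ Z, ((β / π) ^ 4 * b i) * (rexp (-β * ‖v‖ ^ 2) * cos (θ i + ⟪z i, v⟫)) := by
      intro v; simp only [hρ, hf]; rw [Finset.mul_sum]
      refine Finset.sum_congr rfl fun i _ => ?_
      ring
    simp_rw [this]
    rw [integral_finsetSum _ fun i _ => (gauss_cos_shift hβ _ _).1.const_mul _]
    refine Finset.sum_congr rfl fun i _ => ?_
    rw [integral_const_mul, (gauss_cos_shift hβ _ _).2, pow_P8, ← ea]
    field_simp
  have vg : ∫ v, ρ v * g v = ∑ i ∈ Z, rexp (-‖z i‖ ^ 2 / R ^ 2) * sin (θ i) := by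
    have : ∀ v, ρ v * g v = ∑ i ∈ Z, ((β / π) ^ 4 * b i) * (rexp (-β * ‖v‖ ^ 2) * sin (θ i + ⟪z i, v⟫)) := by
      intro v; simp only [hρ, hg]; rw [Finset.mul_sum]
      refine Finset.sum_congr rfl fun i _ => ?_
      ring
    simp_rw [this]
    rw [integral_finsetSum _ fun i _ => (gauss_sin_shift hβ _ _).1.const_mul _]
    refine Finset.sum_congr rfl fun i _ => ?_
    rw [integral_const_mul, (gauss_sin_shift hβ _ _).2, pow_P8, ← ea]
    field_simp
  have j1 := jensen ρ f hρ0 hρi hρ1 hf1 hf2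
  have j2 := jensen ρ g hρ0 hρi hρ1 hg1 hg2
  have e : ∀ v, ρ v * NN Z b (fun i => θ i + ⟪z i, v⟫) = ρ v * f v ^ 2 + ρ v * g v ^ 2 := by
    intro v; unfold NN; simp only [hf, hg]; ring
  have : ∫⁻ v : P8, ENNReal.ofReal (ρ v * NN Z b (fun i => θ i + ⟪z i, v⟫)) =
      ENNReal.ofReal (∫ v, ρ v * f v ^ 2 + ρ v * g v ^ 2) := by
    simp_rw [e]
    have hs : Integrable (fun v => ρ v * f v ^ 2 + ρ v * g v ^ 2) := hf2.add hg2
    exact (ofReal_integral_eq_lintegral_ofReal hs (Filter.Eventually.of_forall fun v =>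
      add_nonneg (mul_nonneg (hρ0 v) (sq_nonneg _)) (mul_nonneg (hρ0 v) (sq_nonneg _)))).symm
  rw [this]
  apply ENNReal.ofReal_le_ofReal
  rw [integral_add hf2 hg2]
  unfold NN
  rw [← vf, ← vg]
  exact add_le_add j1 j2
end Aux

namespace Aux
open MeasureTheory Real
open scoped RealInnerProductSpace ENNReal

def mfun (k : ℝ) (ξ : P8) : ℝ≥0∞ :=
  ∫⁻ p : ℂ × C2, ENNReal.ofReal (k ^ 8 *
    rexp (-‖p.1‖ ^ 2 / 2 - ‖p.2‖ ^ 2 / (4 * k ^ 2) - k ^ 2 * ‖ξ - cone p‖ ^ 2 / 8))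

lemma cone_sub (p p0 : ℂ × C2) : ‖cone p - cone p0‖ ^ 2 =
    ‖p.2 - p0.2‖ ^ 2 + ‖(starRingEnd ℂ) p.1 • p.2 - (starRingEnd ℂ) p0.1 • p0.2‖ ^ 2 := by
  have : cone p - cone p0 =
    pt (p.2 - p0.2) ((starRingEnd ℂ) p.1 • p.2 - (starRingEnd ℂ) p0.1 • p0.2) := rfl
  rw [this, pt_norm]

lemma cone_near {k : ℝ} (hk : 1 ≤ k) (p p0 : ℂ × C2)
    (h1 : ‖p.1 - p0.1‖ ≤ 1 / (k * (k + ‖p0.2‖)))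
    (h2 : ‖p.2 - p0.2‖ ≤ 1 / (k * (1 + ‖p0.1‖))) :
    ‖cone p - cone p0‖ ^ 2 ≤ 5 / k ^ 2 ∧ ‖p.1 - p0.1‖ ≤ 1 ∧ ‖p.2 - p0.2‖ ≤ 1 := by
  have hk0 : 0 < k := by linarith
  have n1 := norm_nonneg p0.1
  have n2 := norm_nonneg p0.2
  have n3 := norm_nonneg (p.1 - p0.1)
  have n4 := norm_nonneg (p.2 - p0.2)
  rw [le_div_iff₀ (by positivity)] at h1 h2
  have a1 : ‖p.1 - p0.1‖ ≤ 1 := by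
    by_contra h
    push Not at h
    have : 1 ≤ k * (k + ‖p0.2‖) := by nlinarith
    nlinarith
  have a2 : ‖p.2 - p0.2‖ ≤ 1 := by
    by_contra h
    push Not at h
    have : 1 ≤ k * (1 + ‖p0.1‖) := by nlinarith
    nlinarith
  refine ⟨?_, a1, a2⟩
  have b1 : k * ‖p.2 - p0.2‖ ≤ 1 := by
    have : 0 ≤ k * ‖p.2 - p0.2‖ * ‖p0.1‖ := by positivity
    nlinarith
  have b2 : k * (‖p.1 - p0.1‖ * ‖p0.2‖) ≤ 1 := by
    have : 0 ≤ k * ‖p.1 - p0.1‖ * k := by positivity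
    nlinarith
  have b3 : k * (‖p.1‖ * ‖p.2 - p0.2‖) ≤ 1 := by
    have : ‖p.1‖ ≤ 1 + ‖p0.1‖ := by
      have := norm_add_le (p.1 - p0.1) p0.1
      simp only [sub_add_cancel] at this
      linarith
    have h3 : ‖p.1‖ * (k * ‖p.2 - p0.2‖) ≤ (1 + ‖p0.1‖) * (k * ‖p.2 - p0.2‖) :=
      mul_le_mul_of_nonneg_right this (by positivity)
    nlinarith
  rw [cone_sub]
  have e : (starRingEnd ℂ) p.1 • p.2 - (starRingEnd ℂ) p0.1 • p0.2 =
      (starRingEnd ℂ) p.1 • (p.2 - p0.2) + (starRingEnd ℂ) (p.1 - p0.1) • p0.2 := by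
    rw [smul_sub, map_sub, sub_smul]; abel
  have c1 : k * ‖(starRingEnd ℂ) p.1 • p.2 - (starRingEnd ℂ) p0.1 • p0.2‖ ≤ 2 := by
    rw [e]
    have := norm_add_le ((starRingEnd ℂ) p.1 • (p.2 - p0.2)) ((starRingEnd ℂ) (p.1 - p0.1) • p0.2)
    rw [norm_smul, norm_smul, RCLike.norm_conj, RCLike.norm_conj] at this
    have := mul_le_mul_of_nonneg_left this hk0.le
    linarith
  rw [le_div_iff₀ (by positivity)]
  have d1 := pow_le_pow_left₀ (by positivity) b1 2
  have d2 := pow_le_pow_left₀ (by positivity) c1 2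
  rw [mul_pow] at d1 d2
  linarith

lemma five_four {V : Type*} [NormedAddCommGroup V] (u v : V) (h : ‖u - v‖ ≤ 1) :
    ‖u‖ ^ 2 ≤ 5 / 4 * ‖v‖ ^ 2 + 5 := by
  have h1 : ‖u‖ ≤ ‖v‖ + 1 := by
    have := norm_add_le v (u - v)
    simp only [add_sub_cancel] at this
    linarith
  nlinarith [norm_nonneg u, norm_nonneg v, sq_nonneg (‖v‖ - 4)]

lemma absorb1 (t : ℝ) (ht : 0 ≤ t) : (1 + t) ^ 2 ≤ 5 * rexp (7 / 16 * t ^ 2) := by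
  have := add_one_le_exp (7 / 16 * t ^ 2)
  nlinarith [sq_nonneg (1 - t)]

lemma absorb2 (t : ℝ) (ht : 0 ≤ t) : (1 + t) ^ 4 ≤ 1024 * rexp (1 / 8 * t ^ 2) := by
  have h := add_one_le_exp (1 / 16 * t ^ 2)
  have h1 : rexp (1 / 8 * t ^ 2) = rexp (1 / 16 * t ^ 2) ^ 2 := by
    rw [← exp_nat_mul]; congr 1; push_cast; ring
  have h2 : (1 + t) ^ 2 ≤ 32 * rexp (1 / 16 * t ^ 2) := by nlinarith [sq_nonneg (1 - t)]
  rw [h1]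
  have := pow_le_pow_left₀ (by positivity) h2 2
  nlinarith

lemma m_lower : ∃ c : ℝ, 0 < c ∧ ∀ k : ℝ, 1 ≤ k → ∀ (ξ : P8) (p0 : ℂ × C2),
    ENNReal.ofReal (c * rexp (-(3 / 4) * ‖p0.1‖ ^ 2 - 3 / 4 * (‖p0.2‖ ^ 2 / k ^ 2) -
      k ^ 2 * ‖ξ - cone p0‖ ^ 2 / 4)) ≤ mfun k ξ := by
  have hwC : 0 < (volume (ball (0 : ℂ) 1)).toReal :=
    ENNReal.toReal_pos (measure_ball_pos _ _ (by norm_num)).ne' measure_ball_lt_top.ne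
  have hwE : 0 < (volume (ball (0 : C2) 1)).toReal :=
    ENNReal.toReal_pos (measure_ball_pos _ _ (by norm_num)).ne' measure_ball_lt_top.ne
  set wC := (volume (ball (0 : ℂ) 1)).toReal with hwCd
  set wE := (volume (ball (0 : C2) 1)).toReal with hwEd
  refine ⟨rexp (-5) * wC * wE / (5 * 1024), by positivity, ?_⟩
  intro k hk ξ p0
  have hk0 : 0 < k := by linarith
  set ρ := 1 / (k * (k + ‖p0.2‖)) with hρ
  set σ := 1 / (k * (1 + ‖p0.1‖)) with hσ
  have hρ0 : 0 < ρ := by positivity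
  have hσ0 : 0 < σ := by positivity
  set D : Set (ℂ × C2) := closedBall p0.1 ρ ×ˢ closedBall p0.2 σ with hD
  have hDm : MeasurableSet D := measurableSet_closedBall.prod measurableSet_closedBall
  have hDv : volume D = ENNReal.ofReal (ρ ^ 2 * wC * (σ ^ 4 * wE)) := by
    rw [hD, Measure.volume_eq_prod, Measure.prod_prod, Measure.addHaar_closedBall _ _ hρ0.le,
      Measure.addHaar_closedBall _ _ hσ0.le, finrank_C2, Complex.finrank_real_complex,
      ENNReal.ofReal_mul (by positivity), ENNReal.ofReal_mul (by positivity),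
      ENNReal.ofReal_mul (by positivity), hwCd, hwEd, ENNReal.ofReal_toReal measure_ball_lt_top.ne,
      ENNReal.ofReal_toReal measure_ball_lt_top.ne]
  set val := k ^ 8 * rexp (-5 - 5 / 8 * ‖p0.1‖ ^ 2 - 5 / 16 * (‖p0.2‖ ^ 2 / k ^ 2) -
      k ^ 2 * ‖ξ - cone p0‖ ^ 2 / 4) with hval
  have hlow : ENNReal.ofReal val * volume D ≤ mfun k ξ := by
    unfold mfun
    calc ENNReal.ofReal val * volume D = ∫⁻ p in D, ENNReal.ofReal val := by
          rw [lintegral_const, Measure.restrict_apply_univ]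
      _ ≤ ∫⁻ p in D, ENNReal.ofReal (k ^ 8 *
          rexp (-‖p.1‖ ^ 2 / 2 - ‖p.2‖ ^ 2 / (4 * k ^ 2) - k ^ 2 * ‖ξ - cone p‖ ^ 2 / 8)) := by
          refine setLIntegral_mono' hDm fun p hp => ?_
          apply ENNReal.ofReal_le_ofReal
          apply mul_le_mul_of_nonneg_left _ (by positivity)
          apply exp_le_exp.2
          simp only [hD, Set.mem_prod, mem_closedBall, dist_eq_norm] at hp
          obtain ⟨g1, g2, g3⟩ := cone_near hk p p0 hp.1 hp.2
          have f1 := five_four _ _ g2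
          have f2 := five_four _ _ g3
          have f3 := nsq_le (ξ - cone p) (ξ - cone p0)
          rw [show ξ - cone p - (ξ - cone p0) = -(cone p - cone p0) by abel, norm_neg] at f3
          have f4 : k ^ 2 * ‖ξ - cone p‖ ^ 2 ≤ 2 * (k ^ 2 * ‖ξ - cone p0‖ ^ 2) + 10 := by
            rw [le_div_iff₀ (by positivity)] at g1
            have := mul_le_mul_of_nonneg_left f3 (sq_nonneg k)
            linarith
          have f5 : ‖p.2‖ ^ 2 / (4 * k ^ 2) ≤ 5 / 16 * (‖p0.2‖ ^ 2 / k ^ 2) + 5 / 4 := by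
            rw [div_le_iff₀ (by positivity)]
            have : (5 / 16 * (‖p0.2‖ ^ 2 / k ^ 2) + 5 / 4) * (4 * k ^ 2) =
              5 / 4 * ‖p0.2‖ ^ 2 + 5 * k ^ 2 := by field_simp; ring
            rw [this]
            nlinarith
          linarith
      _ ≤ _ := setLIntegral_le_lintegral _ _
  refine le_trans ?_ hlow
  rw [hDv, ← ENNReal.ofReal_mul (by positivity)]
  apply ENNReal.ofReal_le_ofReal
  have t1 := absorb1 (‖p0.2‖ / k) (by positivity)
  have t2 := absorb2 ‖p0.1‖ (by positivity)
  have e1 : k ^ 8 * (ρ ^ 2 * wC * (σ ^ 4 * wE)) =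
     wC * wE / ((1 + ‖p0.2‖ / k) ^ 2 * (1 + ‖p0.1‖) ^ 4) := by
    rw [hρ, hσ]
    field_simp
  have e2 : val * (ρ ^ 2 * wC * (σ ^ 4 * wE)) = wC * wE /
      ((1 + ‖p0.2‖ / k) ^ 2 * (1 + ‖p0.1‖) ^ 4) * rexp (-5 - 5 / 8 * ‖p0.1‖ ^ 2 -
        5 / 16 * (‖p0.2‖ ^ 2 / k ^ 2) - k ^ 2 * ‖ξ - cone p0‖ ^ 2 / 4) := by
    rw [← e1, hval]; ring
  rw [e2]
  have e3 : rexp (-5 - 5 / 8 * ‖p0.1‖ ^ 2 -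
        5 / 16 * (‖p0.2‖ ^ 2 / k ^ 2) - k ^ 2 * ‖ξ - cone p0‖ ^ 2 / 4) =
      rexp (-5) * rexp (7 / 16 * (‖p0.2‖ / k) ^ 2) * rexp (1 / 8 * ‖p0.1‖ ^ 2) *
      rexp (-(3 / 4) * ‖p0.1‖ ^ 2 - 3 / 4 * (‖p0.2‖ ^ 2 / k ^ 2) -
      k ^ 2 * ‖ξ - cone p0‖ ^ 2 / 4) := by
    rw [← exp_add, ← exp_add, ← exp_add]; congr 1; rw [div_pow]; ring
  rw [e3]
  set X := rexp (-(3 / 4) * ‖p0.1‖ ^ 2 - 3 / 4 * (‖p0.2‖ ^ 2 / k ^ 2) -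
      k ^ 2 * ‖ξ - cone p0‖ ^ 2 / 4)
  set u := rexp (7 / 16 * (‖p0.2‖ / k) ^ 2)
  set v := rexp (1 / 8 * ‖p0.1‖ ^ 2)
  have hX : 0 < X := exp_pos _
  have hu : 0 < u := exp_pos _
  have hv : 0 < v := exp_pos _
  have t3 := mul_le_mul t1 t2 (by positivity) (by positivity)
  set d := (1 + ‖p0.2‖ / k) ^ 2 * (1 + ‖p0.1‖) ^ 4
  have hd : 0 < d := by positivity
  rw [div_mul_eq_mul_div, div_mul_eq_mul_div, div_le_div_iff₀ (by positivity) hd]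
  have hc : 0 ≤ rexp (-5) * wC * wE * X := by positivity
  have := mul_le_mul_of_nonneg_left t3 hc
  calc _ ≤ _ := this
    _ = _ := by ring

/-- coordinatewise conjugation -/
def cj (a : C2) : C2 := WithLp.toLp 2 fun i => (starRingEnd ℂ) (a i)

lemma norm_cj_sub (ξ η : C2) (l : ℂ) :
    ‖ξ - (starRingEnd ℂ) l • η‖ = ‖cj ξ + l • (-cj η)‖ := by
  have h : ‖ξ - (starRingEnd ℂ) l • η‖ ^ 2 = ‖cj ξ + l • (-cj η)‖ ^ 2 := by
    simp only [EuclideanSpace.norm_sq_eq, Fin.sum_univ_two, cj, Complex.sq_norm,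
      Complex.normSq_apply]
    simp
    ring
  exact (sq_eq_sq₀ (norm_nonneg _) (norm_nonneg _)).1 h

lemma norm_cj (η : C2) : ‖-cj η‖ ^ 2 = ‖η‖ ^ 2 := by
    simp only [EuclideanSpace.norm_sq_eq, Fin.sum_univ_two, cj, Complex.sq_norm,
      Complex.normSq_apply]
    simp

lemma l_int {κ : ℝ} (hκ : 0 < κ) (ξ η : C2) (hη : η ≠ 0) :
    ∫⁻ l : ℂ, ENNReal.ofReal (rexp (-κ * ‖ξ - (starRingEnd ℂ) l • η‖ ^ 2)) ≤
      ENNReal.ofReal (π / (κ * ‖η‖ ^ 2)) := by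
  have hn : 0 < ‖η‖ := norm_pos_iff.2 hη
  have hp : 0 < 0 + κ * ‖-cj η‖ ^ 2 := by rw [norm_cj]; positivity
  obtain ⟨h1, h2⟩ := HH_int (cj ξ) (-cj η) hp
  have e : ∀ l : ℂ, rexp (-κ * ‖ξ - (starRingEnd ℂ) l • η‖ ^ 2) =
      rexp (-0 * ‖l‖ ^ 2 - κ * ‖cj ξ + l • (-cj η)‖ ^ 2) := by
    intro l; rw [norm_cj_sub]; congr 1; ring
  simp_rw [e]
  rw [← ofReal_integral_eq_lintegral_ofReal h1 (Filter.Eventually.of_forall fun l => (exp_pos _).le),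
    h2]
  apply ENNReal.ofReal_le_ofReal
  unfold HH
  rw [norm_cj, zero_add]
  apply mul_le_of_le_one_right (by positivity)
  rw [exp_le_one_iff, zero_mul, zero_mul, zero_add, neg_div]
  have : 0 ≤ κ ^ 2 * ‖qf (cj ξ) (-cj η)‖ ^ 2 / (κ * ‖η‖ ^ 2) := by positivity
  linarith

lemma cone_gauss_int {κ k : ℝ} (hκ : 0 < κ) (hk : 0 < k) (ξ : P8) :
    ∫⁻ p : ℂ × C2, ENNReal.ofReal (‖p.2‖ ^ 2 / k ^ 2 * rexp (-κ * ‖ξ - cone p‖ ^ 2)) ≤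
      ENNReal.ofReal (π / (κ * k ^ 2) * (π / κ) ^ 2) := by
  rw [Measure.volume_eq_prod, lintegral_prod_symm _ (by
    refine Measurable.aemeasurable ?_
    have := cont_cone
    fun_prop)]
  calc ∫⁻ η : C2, ∫⁻ l : ℂ, ENNReal.ofReal (‖η‖ ^ 2 / k ^ 2 * rexp (-κ * ‖ξ - cone (l, η)‖ ^ 2))
      ≤ ∫⁻ η : C2, ENNReal.ofReal (π / (κ * k ^ 2)) *
          ENNReal.ofReal (rexp (-κ * ‖η - ξ.ofLp.1‖ ^ 2)) := by
        refine lintegral_mono fun η => ?_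
        by_cases hη : η = 0
        · simp [hη]
        have hn : 0 < ‖η‖ := norm_pos_iff.2 hη
        have e : ∀ l : ℂ, ENNReal.ofReal (‖η‖ ^ 2 / k ^ 2 * rexp (-κ * ‖ξ - cone (l, η)‖ ^ 2)) =
          ENNReal.ofReal (‖η‖ ^ 2 / k ^ 2 * rexp (-κ * ‖η - ξ.ofLp.1‖ ^ 2)) *
          ENNReal.ofReal (rexp (-κ * ‖ξ.ofLp.2 - (starRingEnd ℂ) l • η‖ ^ 2)) := by
          intro l
          rw [← ENNReal.ofReal_mul (by positivity), mul_assoc, ← exp_add]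
          have : ξ - cone (l, η) = pt (ξ.ofLp.1 - η) (ξ.ofLp.2 - (starRingEnd ℂ) l • η) := rfl
          rw [this, pt_norm, norm_sub_rev η]
          congr 3; ring
        simp_rw [e]
        rw [lintegral_const_mul' _ _ ENNReal.ofReal_ne_top]
        refine (mul_le_mul_right (l_int hκ _ η hη) _).trans (le_of_eq ?_)
        rw [← ENNReal.ofReal_mul (by positivity), ← ENNReal.ofReal_mul (by positivity)]
        congr 1
        field_simp
    _ = _ := by
      rw [lintegral_const_mul' _ _ ENNReal.ofReal_ne_top, lint_gauss_C2 hκ,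
        ← ENNReal.ofReal_mul (by positivity)]

def Mfun (R k : ℝ) (ξ : P8) : ℝ≥0∞ :=
  ∫⁻ p : ℂ × C2, ENNReal.ofReal
    (rexp (-‖p.1‖ ^ 2) * (‖p.2‖ ^ 2 / k ^ 2 * rexp (-‖p.2‖ ^ 2 / k ^ 2)) *
      (((R ^ 2 / 2) / π) ^ 4 * rexp (-(R ^ 2 / 2) * ‖ξ - cone p‖ ^ 2)))

lemma M_le_m : ∃ C : ℝ, 0 < C ∧ ∀ R k : ℝ, 1 ≤ k → k ≤ R → ∀ ξ : P8,
    Mfun R k ξ ≤ ENNReal.ofReal (C * (R / k) ^ 2) * mfun k ξ := by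
  obtain ⟨c, hc, hm⟩ := m_lower
  refine ⟨(1 / 2 / π) ^ 4 * (4 * π) ^ 3 / c, by positivity, ?_⟩
  intro R k hk hkR ξ
  have hk0 : 0 < k := by linarith
  have hR0 : 0 < R := by linarith
  unfold Mfun
  calc _ ≤ ∫⁻ p : ℂ × C2, (mfun k ξ * ENNReal.ofReal (((R ^ 2 / 2) / π) ^ 4 / c)) *
        ENNReal.ofReal (‖p.2‖ ^ 2 / k ^ 2 * rexp (-(R ^ 2 / 4) * ‖ξ - cone p‖ ^ 2)) := by
        refine lintegral_mono fun p => ?_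
        refine le_trans ?_ (mul_le_mul_left (mul_le_mul_left (hm k hk ξ p) _) _)
        rw [← ENNReal.ofReal_mul (by positivity), ← ENNReal.ofReal_mul (by positivity)]
        apply ENNReal.ofReal_le_ofReal
        have e1 : c * rexp (-(3 / 4) * ‖p.1‖ ^ 2 - 3 / 4 * (‖p.2‖ ^ 2 / k ^ 2) -
          k ^ 2 * ‖ξ - cone p‖ ^ 2 / 4) * ((R ^ 2 / 2 / π) ^ 4 / c) *
          (‖p.2‖ ^ 2 / k ^ 2 * rexp (-(R ^ 2 / 4) * ‖ξ - cone p‖ ^ 2)) =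
          ((R ^ 2 / 2 / π) ^ 4 * (‖p.2‖ ^ 2 / k ^ 2)) *
          (rexp (-(3 / 4) * ‖p.1‖ ^ 2 - 3 / 4 * (‖p.2‖ ^ 2 / k ^ 2) -
          k ^ 2 * ‖ξ - cone p‖ ^ 2 / 4) * rexp (-(R ^ 2 / 4) * ‖ξ - cone p‖ ^ 2)) := by
          field_simp
        have e2 : rexp (-‖p.1‖ ^ 2) * (‖p.2‖ ^ 2 / k ^ 2 * rexp (-‖p.2‖ ^ 2 / k ^ 2)) *
          ((R ^ 2 / 2 / π) ^ 4 * rexp (-(R ^ 2 / 2) * ‖ξ - cone p‖ ^ 2)) =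
          ((R ^ 2 / 2 / π) ^ 4 * (‖p.2‖ ^ 2 / k ^ 2)) *
           (rexp (-‖p.1‖ ^ 2) * rexp (-‖p.2‖ ^ 2 / k ^ 2) *
             rexp (-(R ^ 2 / 2) * ‖ξ - cone p‖ ^ 2)) := by ring
        rw [e1, e2]
        apply mul_le_mul_of_nonneg_left _ (by positivity)
        rw [← exp_add, ← exp_add, ← exp_add]
        apply exp_le_exp.2
        have f1 : k ^ 2 ≤ R ^ 2 := by nlinarith
        have f2 : k ^ 2 * ‖ξ - cone p‖ ^ 2 ≤ R ^ 2 * ‖ξ - cone p‖ ^ 2 :=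
          mul_le_mul_of_nonneg_right f1 (by positivity)
        have f3 : 0 ≤ ‖p.2‖ ^ 2 / k ^ 2 := by positivity
        rw [neg_div]
        nlinarith [sq_nonneg ‖p.1‖]
    _ ≤ ENNReal.ofReal (((1 / 2 / π) ^ 4 * (4 * π) ^ 3 / c) * (R / k) ^ 2) * mfun k ξ := by
        by_cases ht : mfun k ξ = ⊤
        · rw [ht, ENNReal.mul_top]
          · exact le_top
          · have : 0 < ((1 / 2 / π) ^ 4 * (4 * π) ^ 3 / c) * (R / k) ^ 2 := by positivity
            simpa using this
        rw [lintegral_const_mul' _ _ (ENNReal.mul_ne_top ht ENNReal.ofReal_ne_top)]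
        refine (mul_le_mul_right (cone_gauss_int (by positivity) hk0 ξ) _).trans (le_of_eq ?_)
        rw [mul_assoc, ← ENNReal.ofReal_mul (by positivity), mul_comm]
        congr 2
        field_simp
end Aux

namespace Aux
open MeasureTheory Real
open scoped RealInnerProductSpace ENNReal

lemma two_gauss (μ : ℝ) (hμ : 0 < μ) (z z' : P8) :
    Integrable (fun w : P8 => rexp (-μ * ‖z - w‖ ^ 2) * rexp (-μ * ‖z' - w‖ ^ 2)) ∧
    ∫ w : P8, rexp (-μ * ‖z - w‖ ^ 2) * rexp (-μ * ‖z' - w‖ ^ 2) =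
      (π / (2 * μ)) ^ 4 * rexp (-μ * ‖z - z'‖ ^ 2 / 2) := by
  have e : (fun w : P8 => rexp (-μ * ‖z - w‖ ^ 2) * rexp (-μ * ‖z' - w‖ ^ 2)) = fun w =>
      rexp (-μ * (‖z‖ ^ 2 + ‖z'‖ ^ 2)) *
        rexp (-(2 * μ) * ‖w‖ ^ 2 + ⟪(2 * μ) • (z + z'), w⟫) := by
    ext w
    rw [← exp_add, ← exp_add]
    congr 1
    rw [norm_sub_sq_real, norm_sub_sq_real, inner_smul_left, inner_add_left]
    simp only [conj_trivial]
    ring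
  rw [e]
  have h2 : 0 < 2 * μ := by positivity
  refine ⟨(integrable_gauss_lin h2 _).const_mul _, ?_⟩
  rw [integral_const_mul, integral_gauss_lin h2, pow_P8, mul_left_comm, ← exp_add]
  congr 2
  rw [norm_smul, mul_pow, norm_add_sq_real, norm_sub_sq_real, Real.norm_eq_abs, sq_abs]
  field_simp
  ring

lemma shift_eq {ι : Type*} (Z : Finset ι) (a : ι → ℝ) (z : ι → P8) (θ : ι → ℝ) {β : ℝ}
    (hβ : 0 < β) :
    ∫⁻ v : P8, ENNReal.ofReal (rexp (-β * ‖v‖ ^ 2) * NN Z a (fun i => θ i + ⟪z i, v⟫)) =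
    ENNReal.ofReal (1 / β ^ 8) *
      ∫⁻ w : P8, ENNReal.ofReal (NN Z (fun i => a i * rexp (-(1 / (2 * β)) * ‖z i - w‖ ^ 2)) θ) := by
  have hμ : 0 < 1 / (2 * β) := by positivity
  set S := ∑ i ∈ Z, ∑ j ∈ Z, a i * a j * (rexp (-‖z i - z j‖ ^ 2 / (4 * β)) * cos (θ i - θ j)) with hS
  have h1 : ∫⁻ v : P8, ENNReal.ofReal (rexp (-β * ‖v‖ ^ 2) * NN Z a (fun i => θ i + ⟪z i, v⟫)) =
      ENNReal.ofReal ((π / β) ^ 4 * S) := by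
    have e : (fun v : P8 => rexp (-β * ‖v‖ ^ 2) * NN Z a (fun i => θ i + ⟪z i, v⟫)) = fun v =>
        ∑ i ∈ Z, ∑ j ∈ Z, a i * a j *
          (rexp (-β * ‖v‖ ^ 2) * cos ((θ i - θ j) + ⟪z i - z j, v⟫)) := by
      ext v
      rw [NN_eq, Finset.mul_sum]
      refine Finset.sum_congr rfl fun i _ => ?_
      rw [Finset.mul_sum]
      refine Finset.sum_congr rfl fun j _ => ?_
      rw [inner_sub_left, show θ i + ⟪z i, v⟫ - (θ j + ⟪z j, v⟫) =
        θ i - θ j + (⟪z i, v⟫ - ⟪z j, v⟫) by ring]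
      ring
    have hij : ∀ i j, Integrable (fun v : P8 => a i * a j *
          (rexp (-β * ‖v‖ ^ 2) * cos ((θ i - θ j) + ⟪z i - z j, v⟫))) := fun i j =>
      (gauss_cos_shift hβ _ _).1.const_mul _
    have hi : ∀ i, Integrable (fun v : P8 => ∑ j ∈ Z, a i * a j *
          (rexp (-β * ‖v‖ ^ 2) * cos ((θ i - θ j) + ⟪z i - z j, v⟫))) := fun i =>
      integrable_finsetSum _ fun j _ => hij i j
    rw [← ofReal_integral_eq_lintegral_ofReal (by rw [e]; exact integrable_finsetSum _ fun i _ => hi i)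
      (Filter.Eventually.of_forall fun v => mul_nonneg (exp_pos _).le (NN_nonneg _ _ _))]
    congr 1
    rw [e, integral_finsetSum _ fun i _ => hi i, hS, Finset.mul_sum]
    refine Finset.sum_congr rfl fun i _ => ?_
    rw [integral_finsetSum _ fun j _ => hij i j, Finset.mul_sum]
    refine Finset.sum_congr rfl fun j _ => ?_
    rw [integral_const_mul, (gauss_cos_shift hβ _ _).2, pow_P8]
    ring
  have h2 : ∫⁻ w : P8, ENNReal.ofReal
      (NN Z (fun i => a i * rexp (-(1 / (2 * β)) * ‖z i - w‖ ^ 2)) θ) =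
      ENNReal.ofReal ((π * β) ^ 4 * S) := by
    have e : (fun w : P8 => NN Z (fun i => a i * rexp (-(1 / (2 * β)) * ‖z i - w‖ ^ 2)) θ) = fun w =>
        ∑ i ∈ Z, ∑ j ∈ Z, a i * a j * cos (θ i - θ j) *
          (rexp (-(1 / (2 * β)) * ‖z i - w‖ ^ 2) * rexp (-(1 / (2 * β)) * ‖z j - w‖ ^ 2)) := by
      ext v
      rw [NN_eq]
      refine Finset.sum_congr rfl fun i _ => ?_
      refine Finset.sum_congr rfl fun j _ => ?_
      ring
    have hij : ∀ i j, Integrable (fun w : P8 => a i * a j * cos (θ i - θ j) *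
          (rexp (-(1 / (2 * β)) * ‖z i - w‖ ^ 2) * rexp (-(1 / (2 * β)) * ‖z j - w‖ ^ 2))) :=
      fun i j => (two_gauss _ hμ _ _).1.const_mul _
    have hi : ∀ i, Integrable (fun w : P8 => ∑ j ∈ Z, a i * a j * cos (θ i - θ j) *
          (rexp (-(1 / (2 * β)) * ‖z i - w‖ ^ 2) * rexp (-(1 / (2 * β)) * ‖z j - w‖ ^ 2))) :=
      fun i => integrable_finsetSum _ fun j _ => hij i j
    rw [← ofReal_integral_eq_lintegral_ofReal (by rw [e]; exact integrable_finsetSum _ fun i _ => hi i)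
      (Filter.Eventually.of_forall fun v => NN_nonneg _ _ _)]
    congr 1
    rw [e, integral_finsetSum _ fun i _ => hi i, hS, Finset.mul_sum]
    refine Finset.sum_congr rfl fun i _ => ?_
    rw [integral_finsetSum _ fun j _ => hij i j, Finset.mul_sum]
    refine Finset.sum_congr rfl fun j _ => ?_
    rw [integral_const_mul, (two_gauss _ hμ _ _).2]
    have : -(1 / (2 * β)) * ‖z i - z j‖ ^ 2 / 2 = -‖z i - z j‖ ^ 2 / (4 * β) := by
      field_simp; ring
    rw [this]
    have : π / (2 * (1 / (2 * β))) = π * β := by field_simp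
    rw [this]
    ring
  rw [h1, h2, ← ENNReal.ofReal_mul (by positivity)]
  congr 1
  field_simp

lemma mix_eq {ι : Type*} (Z : Finset ι) (b : ι → ℝ) (x y : ι → C2) {k : ℝ} (hk : 0 < k) :
    ∫⁻ ξ : P8, ENNReal.ofReal (NN Z b (fun i => ⟪pt (x i) (y i), ξ⟫)) * mfun k ξ =
    ENNReal.ofReal (8 ^ 8 / k ^ 8) * ∫⁻ w : P8,
      Psi Z (fun i => b i * rexp (-(4 / k ^ 2) * ‖pt (x i) (y i) - w‖ ^ 2)) x y (1 / 2)
        (1 / (4 * k ^ 2)) := by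
  have hcc := cont_cone
  unfold mfun
  set z : ι → P8 := fun i => pt (x i) (y i) with hz
  have hβ : 0 < k ^ 2 / 8 := by positivity
  calc _ = ∫⁻ ξ : P8, ∫⁻ p : ℂ × C2, ENNReal.ofReal (k ^ 8 *
    rexp (-‖p.1‖ ^ 2 / 2 - ‖p.2‖ ^ 2 / (4 * k ^ 2))) *
      ENNReal.ofReal (rexp (-(k ^ 2 / 8) * ‖ξ - cone p‖ ^ 2) * NN Z b (fun i => ⟪z i, ξ⟫)) := by
        refine lintegral_congr fun ξ => ?_
        rw [← lintegral_const_mul' _ _ ENNReal.ofReal_ne_top]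
        refine lintegral_congr fun p => ?_
        rw [← ENNReal.ofReal_mul (NN_nonneg _ _ _), ← ENNReal.ofReal_mul (by positivity)]
        congr 1
        rw [sub_eq_add_neg _ (k ^ 2 * ‖ξ - cone p‖ ^ 2 / 8), exp_add,
          show -(k ^ 2 * ‖ξ - cone p‖ ^ 2 / 8) = -(k ^ 2 / 8) * ‖ξ - cone p‖ ^ 2 by ring]
        ring
    _ = ∫⁻ p : ℂ × C2, ∫⁻ ξ : P8, ENNReal.ofReal (k ^ 8 *
    rexp (-‖p.1‖ ^ 2 / 2 - ‖p.2‖ ^ 2 / (4 * k ^ 2))) *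
      ENNReal.ofReal (rexp (-(k ^ 2 / 8) * ‖ξ - cone p‖ ^ 2) * NN Z b (fun i => ⟪z i, ξ⟫)) := by
        refine lintegral_lintegral_swap (Measurable.aemeasurable ?_)
        refine Measurable.mul (by fun_prop) (Continuous.measurable ?_).ennreal_ofReal
        refine Continuous.mul (by fun_prop) ?_
        exact cont_NN Z _ _ (fun i => continuous_const) (fun i => by fun_prop)
    _ = ∫⁻ p : ℂ × C2, ∫⁻ w : P8, ENNReal.ofReal (8 ^ 8 / k ^ 8) * ENNReal.ofReal (
    rexp (-(1 / 2) * ‖p.1‖ ^ 2 - 1 / (4 * k ^ 2) * ‖p.2‖ ^ 2) *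
      NN Z (fun i => b i * rexp (-(4 / k ^ 2) * ‖z i - w‖ ^ 2)) (fun i => ⟪z i, cone p⟫)) := by
        refine lintegral_congr fun p => ?_
        rw [lintegral_const_mul' _ _ ENNReal.ofReal_ne_top,
          lintegral_const_mul' _ _ ENNReal.ofReal_ne_top]
        have t := lintegral_sub_right_eq_self (μ := (volume : Measure P8)) (fun v : P8 =>
          ENNReal.ofReal (rexp (-(k ^ 2 / 8) * ‖v‖ ^ 2) *
            NN Z b (fun i => ⟪z i, cone p⟫ + ⟪z i, v⟫))) (cone p)
        have e : ∀ (ξ : P8) (i : ι), ⟪z i, cone p⟫ + ⟪z i, ξ - cone p⟫ = ⟪z i, ξ⟫ := by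
          intro ξ i; rw [← inner_add_right]; congr 1; abel
        simp only [e] at t
        rw [t, shift_eq Z b z _ hβ]
        have e2 : 1 / (2 * (k ^ 2 / 8)) = 4 / k ^ 2 := by field_simp; norm_num
        rw [e2, ← mul_assoc, ← ENNReal.ofReal_mul (by positivity)]
        have e3 : ∀ w : P8, ENNReal.ofReal (
          rexp (-(1 / 2) * ‖p.1‖ ^ 2 - 1 / (4 * k ^ 2) * ‖p.2‖ ^ 2) *
          NN Z (fun i => b i * rexp (-(4 / k ^ 2) * ‖z i - w‖ ^ 2)) (fun i => ⟪z i, cone p⟫)) =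
          ENNReal.ofReal (rexp (-(1 / 2) * ‖p.1‖ ^ 2 - 1 / (4 * k ^ 2) * ‖p.2‖ ^ 2)) *
          ENNReal.ofReal (NN Z (fun i => b i * rexp (-(4 / k ^ 2) * ‖z i - w‖ ^ 2))
            (fun i => ⟪z i, cone p⟫)) := fun w => ENNReal.ofReal_mul (exp_pos _).le
        simp_rw [e3]
        rw [lintegral_const_mul' _ _ ENNReal.ofReal_ne_top, ← mul_assoc,
          ← ENNReal.ofReal_mul (by positivity)]
        congr 2
        rw [show -(1 / 2) * ‖p.1‖ ^ 2 - 1 / (4 * k ^ 2) * ‖p.2‖ ^ 2 =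
          -‖p.1‖ ^ 2 / 2 - ‖p.2‖ ^ 2 / (4 * k ^ 2) by ring]
        field_simp
    _ = ∫⁻ w : P8, ∫⁻ p : ℂ × C2, ENNReal.ofReal (8 ^ 8 / k ^ 8) * ENNReal.ofReal (
    rexp (-(1 / 2) * ‖p.1‖ ^ 2 - 1 / (4 * k ^ 2) * ‖p.2‖ ^ 2) *
      NN Z (fun i => b i * rexp (-(4 / k ^ 2) * ‖z i - w‖ ^ 2)) (fun i => ⟪z i, cone p⟫)) := by
        refine lintegral_lintegral_swap (Measurable.aemeasurable ?_)
        refine Measurable.mul (by fun_prop) (Continuous.measurable ?_).ennreal_ofReal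
        refine Continuous.mul (by fun_prop) ?_
        exact cont_NN Z _ _ (fun i => by fun_prop) (fun i => by fun_prop)
    _ = _ := by
        rw [← lintegral_const_mul' _ _ ENNReal.ofReal_ne_top]
        refine lintegral_congr fun w => ?_
        rw [lintegral_const_mul' _ _ ENNReal.ofReal_ne_top, Psi_prod]

def Phi {ι : Type*} (Z : Finset ι) (x y : ι → C2) (R : ℝ) : ℝ :=
  Ker Z (wt R x y) x y 1 (1 / R ^ 2)

lemma Phi_nonneg {ι : Type*} (Z : Finset ι) (x y : ι → C2) {R : ℝ} (hR : 0 < R) :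
    0 ≤ Phi Z x y R :=
  Ker_nonneg _ _ (fun i => (wt_pos _ _ _ _).le) _ _ (by norm_num) (by positivity)

lemma HH_half (κ : ℝ) (hκ : 0 < κ) (a b : C2) :
    HH (1 / 2) κ a b = 2 * HH 1 κ a (√2 • b) := by
  have h1 : ‖√2 • b‖ ^ 2 = 2 * ‖b‖ ^ 2 := by
    rw [norm_smul, mul_pow, Real.norm_eq_abs, sq_abs, sq_sqrt (by norm_num)]
  have h2 : ‖qf a (√2 • b)‖ ^ 2 = 2 * ‖qf a b‖ ^ 2 := by
    have : qf a (√2 • b) = √2 • qf a b := by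
      simp only [qf, PiLp.smul_apply, smul_sub, mul_smul_comm]
    rw [this, norm_smul, mul_pow, Real.norm_eq_abs, sq_abs, sq_sqrt (by norm_num)]
  unfold HH
  rw [h1, h2]
  have hp : 0 < 1 / 2 + κ * ‖b‖ ^ 2 := by positivity
  have hp2 : 0 < 1 + κ * (2 * ‖b‖ ^ 2) := by positivity
  rw [show -(1 / 2 * κ * ‖a‖ ^ 2 + κ ^ 2 * ‖qf a b‖ ^ 2) / (1 / 2 + κ * ‖b‖ ^ 2) =
    -(1 * κ * ‖a‖ ^ 2 + κ ^ 2 * (2 * ‖qf a b‖ ^ 2)) / (1 + κ * (2 * ‖b‖ ^ 2)) by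
      rw [div_eq_div_iff hp.ne' hp2.ne']; ring]
  have h3 : π / (1 / 2 + κ * ‖b‖ ^ 2) = 2 * (π / (1 + κ * (2 * ‖b‖ ^ 2))) := by
    rw [mul_div_assoc', div_eq_div_iff hp.ne' hp2.ne']
    ring
  rw [h3, mul_assoc]

lemma ker_bound {ι : Type*} (Z : Finset ι) (x y : ι → C2) {R k : ℝ} (hk : 0 < k) (hkR : k ≤ R)
    (w : P8) :
    Ker Z (fun i => rexp (-‖pt (x i) (y i)‖ ^ 2 / (2 * R ^ 2)) *
      rexp (-(4 / k ^ 2) * ‖pt (x i) (y i) - w‖ ^ 2)) x y (1 / 2) (1 / (4 * k ^ 2)) ≤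
    2 * rexp (-(1 / (2 * R ^ 2)) * ‖w - 0‖ ^ 2) *
      Phi Z (fun i => x i - w.ofLp.1) (fun i => √2 • (y i - w.ofLp.2)) (2 * k) := by
  have hR : 0 < R := by linarith
  unfold Phi Ker
  rw [Finset.mul_sum]
  have hb : ∀ i, rexp (-‖pt (x i) (y i)‖ ^ 2 / (2 * R ^ 2)) *
      rexp (-(4 / k ^ 2) * ‖pt (x i) (y i) - w‖ ^ 2) ≤ rexp (-(1 / (4 * R ^ 2)) * ‖w‖ ^ 2) *
      wt (2 * k) (fun i => x i - w.ofLp.1) (fun i => √2 • (y i - w.ofLp.2)) i := by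
    intro i
    unfold wt
    rw [← exp_add, ← exp_add]
    apply exp_le_exp.2
    have h1 := nsq_le w (pt (x i) (y i))
    rw [norm_sub_rev w] at h1
    have h3 : ‖√2 • (y i - w.ofLp.2)‖ ^ 2 = 2 * ‖y i - w.ofLp.2‖ ^ 2 := by
      rw [norm_smul, mul_pow, Real.norm_eq_abs, sq_abs, sq_sqrt (by norm_num)]
    have h4 : ‖pt (x i) (y i) - w‖ ^ 2 = ‖x i - w.ofLp.1‖ ^ 2 + ‖y i - w.ofLp.2‖ ^ 2 := by
      have : pt (x i) (y i) - w = pt (x i - w.ofLp.1) (y i - w.ofLp.2) := rfl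
      rw [this, pt_norm]
    rw [h3]
    set A := ‖x i - w.ofLp.1‖ ^ 2
    set B := ‖y i - w.ofLp.2‖ ^ 2
    have hA : 0 ≤ A := by positivity
    have hB : 0 ≤ B := by positivity
    rw [h4] at h1 ⊢
    set n := ‖pt (x i) (y i)‖ ^ 2
    set m := ‖w‖ ^ 2
    have k1 : (A + B) / R ^ 2 ≤ (A + B) / k ^ 2 := by
      apply div_le_div_of_nonneg_left (by positivity) (by positivity)
      nlinarith
    have k2 : m / R ^ 2 ≤ (2 * n + 2 * (A + B)) / R ^ 2 := by gcongr
    have k3 : -n / (2 * R ^ 2) = -(1 / 2) * (n / R ^ 2) := by field_simp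
    have k4 : -(4 / k ^ 2) * (A + B) = -4 * ((A + B) / k ^ 2) := by ring
    have k5 : -(1 / (4 * R ^ 2)) * m = -(1 / 4) * (m / R ^ 2) := by field_simp
    have k6 : -(A + 2 * B) / (2 * k) ^ 2 = -(1 / 4) * ((A + B) / k ^ 2) - 1 / 4 * (B / k ^ 2) := by
      field_simp; ring
    have k7 : (2 * n + 2 * (A + B)) / R ^ 2 = 2 * (n / R ^ 2) + 2 * ((A + B) / R ^ 2) := by ring
    have k8 : B / k ^ 2 ≤ (A + B) / k ^ 2 := by gcongr; linarith
    have k9 : 0 ≤ B / k ^ 2 := by positivity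
    rw [k3, k4, k5, k6]
    linarith
  refine Finset.sum_le_sum fun i _ => ?_
  rw [Finset.mul_sum]
  refine Finset.sum_le_sum fun j _ => ?_
  have e1 : (2 * k) ^ 2 = 4 * k ^ 2 := by ring
  have e2 : √2 • (y i - w.ofLp.2) - √2 • (y j - w.ofLp.2) = √2 • (y i - y j) := by
    rw [← smul_sub]; congr 1; abel
  have e3 : x i - w.ofLp.1 - (x j - w.ofLp.1) = x i - x j := by abel
  rw [e1, e2, e3, HH_half _ (by positivity)]
  have hm := mul_le_mul (hb i) (hb j) (by positivity) (by
    have := wt_pos (2 * k) (fun i => x i - w.ofLp.1) (fun i => √2 • (y i - w.ofLp.2)) i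
    positivity)
  have hh := HH_nonneg (α := 1) (κ := 1 / (4 * (1 / (4 * k ^ 2)))) (by norm_num) (by positivity)
    (x i - x j) (√2 • (y i - y j))
  have hX : 0 ≤ (π / (1 / (4 * k ^ 2))) ^ 2 * (2 * HH 1 (1 / (4 * (1 / (4 * k ^ 2))))
    (x i - x j) (√2 • (y i - y j))) := by positivity
  refine (mul_le_mul_of_nonneg_right hm hX).trans (le_of_eq ?_)
  have : rexp (-(1 / (2 * R ^ 2)) * ‖w - 0‖ ^ 2) = rexp (-(1 / (4 * R ^ 2)) * ‖w‖ ^ 2) *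
     rexp (-(1 / (4 * R ^ 2)) * ‖w‖ ^ 2) := by
    rw [← exp_add, sub_zero]; congr 1; field_simp; ring
  rw [this]
  ring

lemma lint_gauss_P8 {β : ℝ} (hβ : 0 < β) (w : P8) :
    ∫⁻ v : P8, ENNReal.ofReal (rexp (-β * ‖v - w‖ ^ 2)) = ENNReal.ofReal ((π / β) ^ 4) := by
  rw [lint_gauss hβ, pow_P8]

lemma high_part : ∃ C : ℝ, 0 < C ∧ ∀ {ι : Type} (Z : Finset ι) (x y : ι → C2) (R k B : ℝ),
    1 ≤ k → k ≤ R → (∀ w : P8,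
      Phi Z (fun i => x i - w.ofLp.1) (fun i => √2 • (y i - w.ofLp.2)) (2 * k) ≤ B) →
    TT Z (wt R x y) x y k ≤ ENNReal.ofReal (C * (R / k) ^ 10 * B) := by
  obtain ⟨C, hC, hM⟩ := M_le_m
  refine ⟨C * 8 ^ 8 * 2 * (2 * π) ^ 4, by positivity, ?_⟩
  intro ι Z x y R k B hk hkR hB
  have hk0 : 0 < k := by linarith
  have hR0 : 0 < R := by linarith
  have hB0 : 0 ≤ B := (Phi_nonneg _ _ _ (by positivity)).trans (hB 0)
  have hcc := cont_cone
  set z : ι → P8 := fun i => pt (x i) (y i) with hz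
  set b : ι → ℝ := fun i => rexp (-‖z i‖ ^ 2 / (2 * R ^ 2)) with hb
  have ew : wt R x y = fun i => rexp (-‖z i‖ ^ 2 / R ^ 2) := by
    ext i; simp only [wt, hz, pt_norm]
  have step1 : TT Z (wt R x y) x y k ≤ ∫⁻ p : ℂ × C2, ∫⁻ ξ : P8,
      ENNReal.ofReal (NN Z b (fun i => ⟪z i, ξ⟫)) *
      ENNReal.ofReal (rexp (-‖p.1‖ ^ 2) * (‖p.2‖ ^ 2 / k ^ 2 * rexp (-‖p.2‖ ^ 2 / k ^ 2)) *
      (((R ^ 2 / 2) / π) ^ 4 * rexp (-(R ^ 2 / 2) * ‖ξ - cone p‖ ^ 2))) := by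
    unfold TT
    refine lintegral_mono fun p => ?_
    simp only []
    rw [ENNReal.ofReal_mul (by positivity), ew]
    refine (mul_le_mul_right (conv_bound Z z (fun i => ⟪z i, cone p⟫) R hR0) _).trans (le_of_eq ?_)
    rw [← lintegral_const_mul' _ _ ENNReal.ofReal_ne_top]
    have t := lintegral_sub_right_eq_self (μ := (volume : Measure P8)) (fun v : P8 =>
      ENNReal.ofReal (rexp (-‖p.1‖ ^ 2) * (‖p.2‖ ^ 2 / k ^ 2 * rexp (-‖p.2‖ ^ 2 / k ^ 2))) *
      ENNReal.ofReal (((R ^ 2 / 2) / π) ^ 4 * rexp (-(R ^ 2 / 2) * ‖v‖ ^ 2) *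
      NN Z b (fun i => ⟪z i, cone p⟫ + ⟪z i, v⟫))) (cone p)
    rw [← t]
    refine lintegral_congr fun ξ => ?_
    have e : ∀ (i : ι), ⟪z i, cone p⟫ + ⟪z i, ξ - cone p⟫ = ⟪z i, ξ⟫ := by
      intro i; rw [← inner_add_right]; congr 1; abel
    simp only [e]
    rw [← ENNReal.ofReal_mul (by positivity), ← ENNReal.ofReal_mul (NN_nonneg _ _ _)]
    congr 1
    ring
  have step2 : (∫⁻ p : ℂ × C2, ∫⁻ ξ : P8,
      ENNReal.ofReal (NN Z b (fun i => ⟪z i, ξ⟫)) *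
      ENNReal.ofReal (rexp (-‖p.1‖ ^ 2) * (‖p.2‖ ^ 2 / k ^ 2 * rexp (-‖p.2‖ ^ 2 / k ^ 2)) *
      (((R ^ 2 / 2) / π) ^ 4 * rexp (-(R ^ 2 / 2) * ‖ξ - cone p‖ ^ 2)))) =
      ∫⁻ ξ : P8, ENNReal.ofReal (NN Z b (fun i => ⟪z i, ξ⟫)) * Mfun R k ξ := by
    rw [lintegral_lintegral_swap]
    · refine lintegral_congr fun ξ => ?_
      rw [lintegral_const_mul' _ _ ENNReal.ofReal_ne_top, Mfun]
    · refine Measurable.aemeasurable ?_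
      refine Measurable.mul (Continuous.measurable ?_).ennreal_ofReal (by fun_prop)
      exact cont_NN Z _ _ (fun i => continuous_const) (fun i => by fun_prop)
  have step3 : ∫⁻ ξ : P8, ENNReal.ofReal (NN Z b (fun i => ⟪z i, ξ⟫)) * Mfun R k ξ ≤
      ENNReal.ofReal (C * (R / k) ^ 2) *
        ∫⁻ ξ : P8, ENNReal.ofReal (NN Z b (fun i => ⟪z i, ξ⟫)) * mfun k ξ := by
    rw [← lintegral_const_mul' _ _ ENNReal.ofReal_ne_top]
    refine lintegral_mono fun ξ => ?_
    refine (mul_le_mul_right (hM R k hk hkR ξ) _).trans (le_of_eq ?_)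
    rw [mul_left_comm]
  have step4 : ∫⁻ w : P8, Psi Z (fun i => b i * rexp (-(4 / k ^ 2) * ‖pt (x i) (y i) - w‖ ^ 2)) x y
      (1 / 2) (1 / (4 * k ^ 2)) ≤ ENNReal.ofReal (2 * B * (π / (1 / (2 * R ^ 2))) ^ 4) := by
    rw [ENNReal.ofReal_mul (by positivity), ← lint_gauss_P8 (by positivity) 0,
      ← lintegral_const_mul' _ _ ENNReal.ofReal_ne_top]
    refine lintegral_mono fun w => ?_
    simp only []
    rw [Psi_eq _ _ _ _ (by norm_num) (by positivity), ← ENNReal.ofReal_mul (by positivity)]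
    apply ENNReal.ofReal_le_ofReal
    refine (ker_bound Z x y hk0 hkR w).trans ?_
    refine (mul_le_mul_of_nonneg_left (hB w) (by positivity)).trans (le_of_eq ?_)
    ring
  refine step1.trans (step2.le.trans (step3.trans ?_))
  rw [mix_eq Z b x y hk0]
  refine (mul_le_mul_right (mul_le_mul_right step4 _) _).trans (le_of_eq ?_)
  rw [← ENNReal.ofReal_mul (by positivity), ← ENNReal.ofReal_mul (by positivity)]
  congr 1
  field_simp
end Aux

namespace Aux
open MeasureTheory Real
open scoped RealInnerProductSpace ENNReal

/-- normalised kernel at scale `R` -/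
def HR (R : ℝ) (a b : C2) : ℝ := (π * R ^ 2) ^ 2 * HH 1 (R ^ 2 / 4) a b

lemma HR_nonneg (R : ℝ) (a b : C2) : 0 ≤ HR R a b := by
  have := HH_nonneg (α := 1) (κ := R ^ 2 / 4) (by norm_num) (by positivity) a b
  unfold HR; positivity

lemma Ker_HR {ι : Type*} (Z : Finset ι) (a : ι → ℝ) (x y : ι → C2) {K : ℝ} (hK : 0 < K) :
    Ker Z a x y 1 (1 / K ^ 2) = ∑ i ∈ Z, ∑ j ∈ Z, a i * a j * HR K (x i - x j) (y i - y j) := by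
  unfold Ker HR
  rw [show π / (1 / K ^ 2) = π * K ^ 2 by field_simp,
    show 1 / (4 * (1 / K ^ 2)) = K ^ 2 / 4 by field_simp]

lemma HR_le (R : ℝ) (a b : C2) : HR R a b ≤ π ^ 3 * R ^ 4 := by
  unfold HR HH
  have h1 : π / (1 + R ^ 2 / 4 * ‖b‖ ^ 2) ≤ π := by
    apply div_le_self pi_pos.le
    have : 0 ≤ R ^ 2 / 4 * ‖b‖ ^ 2 := by positivity
    linarith
  have h2 : rexp (-(1 * (R ^ 2 / 4) * ‖a‖ ^ 2 + (R ^ 2 / 4) ^ 2 * ‖qf a b‖ ^ 2) /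
      (1 + R ^ 2 / 4 * ‖b‖ ^ 2)) ≤ 1 := by
    rw [exp_le_one_iff, neg_div]
    have : 0 ≤ (1 * (R ^ 2 / 4) * ‖a‖ ^ 2 + (R ^ 2 / 4) ^ 2 * ‖qf a b‖ ^ 2) /
      (1 + R ^ 2 / 4 * ‖b‖ ^ 2) := by positivity
    linarith
  have h3 := mul_le_mul h1 h2 (exp_pos _).le pi_pos.le
  calc _ ≤ (π * R ^ 2) ^ 2 * (π * 1) := mul_le_mul_of_nonneg_left h3 (by positivity)
    _ = _ := by ring

lemma HR_case {R L : ℝ} (hL : 1 ≤ L) (hR : 4 * L ≤ R) (a b : C2)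
    (hab : 1 ≤ ‖a‖ ^ 2 + ‖b‖ ^ 2) :
    HR R a b ≤ 2 * L ^ 2 * HR (R / L) a b + π ^ 3 * R ^ 4 * rexp (-(R ^ 2 / (8 * (1 + L ^ 2)))) := by
  have hL0 : 0 < L := by linarith
  have hR0 : 0 < R := by linarith
  by_cases hb : 1 ≤ (R / L) ^ 2 / 4 * ‖b‖ ^ 2
  · have : HR R a b ≤ 2 * L ^ 2 * HR (R / L) a b := by
      unfold HR HH
      set K := R / L with hK
      have hRK : R = L * K := by rw [hK]; field_simp
      have hK0 : 0 < K := by positivity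
      rw [hRK]
      set κ := K ^ 2 / 4 with hκ
      have hκ0 : 0 < κ := by positivity
      have e1 : (L * K) ^ 2 / 4 = L ^ 2 * κ := by rw [hκ]; ring
      rw [e1]
      have hL2 : 1 ≤ L ^ 2 := by nlinarith
      set A := ‖a‖ ^ 2
      set Q := ‖qf a b‖ ^ 2
      set t := ‖b‖ ^ 2
      have hA : 0 ≤ A := by positivity
      have hQ : 0 ≤ Q := by positivity
      have ht : 0 ≤ t := by positivity
      have f1 : π / (1 + L ^ 2 * κ * t) ≤ 2 / L ^ 2 * (π / (1 + κ * t)) := by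
        rw [div_mul_div_comm, div_le_div_iff₀ (by positivity) (by positivity)]
        have : L ^ 2 * (1 + κ * t) ≤ 2 * (1 + L ^ 2 * κ * t) := by nlinarith
        nlinarith [pi_pos]
      have f2 : rexp (-(1 * (L ^ 2 * κ) * A + (L ^ 2 * κ) ^ 2 * Q) / (1 + L ^ 2 * κ * t)) ≤
          rexp (-(1 * κ * A + κ ^ 2 * Q) / (1 + κ * t)) := by
        apply exp_le_exp.2
        rw [neg_div, neg_div, neg_le_neg_iff, div_le_div_iff₀ (by positivity) (by positivity)]
        have g1 : 0 ≤ κ * A := by positivity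
        have g2 : 0 ≤ κ ^ 2 * Q := by positivity
        have g3 : 0 ≤ κ * t := by positivity
        have g4 : 1 + L ^ 2 * (κ * t) ≤ L ^ 2 * (1 + κ * t) := by nlinarith
        have g5 : 1 + L ^ 2 * (κ * t) ≤ L ^ 2 * L ^ 2 * (1 + κ * t) := by
          have h9 : 0 ≤ L ^ 2 * (1 + κ * t) := by positivity
          have h10 : (1:ℝ) ≤ L ^ 2 := by nlinarith
          have := mul_le_mul_of_nonneg_right h10 h9
          linarith
        have g6 := mul_le_mul_of_nonneg_left g4 g1
        have g7 := mul_le_mul_of_nonneg_left g5 g2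
        linarith
      have f3 := mul_le_mul f1 f2 (exp_pos _).le (by positivity)
      refine (mul_le_mul_of_nonneg_left f3 (by positivity)).trans (le_of_eq ?_)
      field_simp
    have h2 : 0 ≤ π ^ 3 * R ^ 4 * rexp (-(R ^ 2 / (8 * (1 + L ^ 2)))) := by positivity
    linarith
  · push Not at hb
    have h1 : R ^ 2 / 4 * ‖b‖ ^ 2 < L ^ 2 := by
      have : (R / L) ^ 2 / 4 * ‖b‖ ^ 2 = R ^ 2 / 4 * ‖b‖ ^ 2 / L ^ 2 := by field_simp
      rw [this, div_lt_one (by positivity)] at hb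
      exact hb
    have h2 : ‖b‖ ^ 2 ≤ 1 / 2 := by
      by_contra h
      push Not at h
      have : 16 * L ^ 2 ≤ R ^ 2 := by nlinarith
      nlinarith
    have h3 : HR R a b ≤ π ^ 3 * R ^ 4 * rexp (-(R ^ 2 / (8 * (1 + L ^ 2)))) := by
      unfold HR HH
      have g1 : π / (1 + R ^ 2 / 4 * ‖b‖ ^ 2) ≤ π := by
        apply div_le_self pi_pos.le
        have : 0 ≤ R ^ 2 / 4 * ‖b‖ ^ 2 := by positivity
        linarith
      have g2 : rexp (-(1 * (R ^ 2 / 4) * ‖a‖ ^ 2 + (R ^ 2 / 4) ^ 2 * ‖qf a b‖ ^ 2) /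
          (1 + R ^ 2 / 4 * ‖b‖ ^ 2)) ≤ rexp (-(R ^ 2 / (8 * (1 + L ^ 2)))) := by
        apply exp_le_exp.2
        rw [neg_div, neg_le_neg_iff, div_le_div_iff₀ (by positivity) (by positivity)]
        have hQ : 0 ≤ (R ^ 2 / 4) ^ 2 * ‖qf a b‖ ^ 2 := by positivity
        have hA : R ^ 2 / 8 ≤ R ^ 2 / 4 * ‖a‖ ^ 2 := by nlinarith
        have hA2 : R ^ 2 / 8 ≤ 1 * (R ^ 2 / 4) * ‖a‖ ^ 2 + (R ^ 2 / 4) ^ 2 * ‖qf a b‖ ^ 2 := by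
          linarith
        have := mul_le_mul_of_nonneg_right hA2 (show 0 ≤ 8 * (1 + L ^ 2) by positivity)
        nlinarith
      have g3 := mul_le_mul g1 g2 (exp_pos _).le pi_pos.le
      refine (mul_le_mul_of_nonneg_left g3 (by positivity)).trans (le_of_eq ?_)
      ring
    have h4 : 0 ≤ 2 * L ^ 2 * HR (R / L) a b := by
      have := HR_nonneg (R / L) a b
      positivity
    linarith

lemma exp_dom {t : ℝ} (ht : 0 < t) : rexp (-t) ≤ 24 / t ^ 4 := by
  rw [exp_neg, le_div_iff₀ (by positivity), inv_mul_le_iff₀ (exp_pos _)]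
  have := pow_div_factorial_le_exp t ht.le 4
  rw [show ((Nat.factorial 4 : ℕ) : ℝ) = 24 by norm_num [Nat.factorial], div_le_iff₀ (by norm_num)] at this
  exact this

lemma crude : ∃ C : ℝ, 0 < C ∧ ∀ {ι : Type} (Z : Finset ι) (x y : ι → C2), Sep Z x y →
    ∀ R : ℝ, 1 ≤ R → Phi Z x y R ≤ C * R ^ 20 := by
  obtain ⟨C, hC, h⟩ := sum_wt
  refine ⟨π ^ 3 * C ^ 2, by positivity, ?_⟩
  intro ι Z x y hs R hR
  have hR0 : 0 < R := by linarith
  unfold Phi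
  rw [Ker_HR _ _ _ _ hR0]
  have hw := fun i => (wt_pos R x y i).le
  calc _ ≤ ∑ i ∈ Z, ∑ j ∈ Z, wt R x y i * wt R x y j * (π ^ 3 * R ^ 4) :=
        Finset.sum_le_sum fun i _ => Finset.sum_le_sum fun j _ =>
          mul_le_mul_of_nonneg_left (HR_le _ _ _) (mul_nonneg (hw i) (hw j))
    _ = (∑ i ∈ Z, wt R x y i) ^ 2 * (π ^ 3 * R ^ 4) := by
        rw [sq, Finset.sum_mul_sum, Finset.sum_mul]
        refine Finset.sum_congr rfl fun i _ => ?_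
        rw [Finset.sum_mul]
    _ ≤ (C * R ^ 8) ^ 2 * (π ^ 3 * R ^ 4) := by
        apply mul_le_mul_of_nonneg_right _ (by positivity)
        exact pow_le_pow_left₀ (Finset.sum_nonneg fun i _ => hw i) (h Z x y hs R hR) 2
    _ = _ := by ring

lemma stepA (L : ℝ) (hL : 1 ≤ L) : ∃ C : ℝ, 0 < C ∧ ∀ {ι : Type} (Z : Finset ι) (x y : ι → C2),
    Sep Z x y → ∀ R : ℝ, 4 * L ≤ R →
    Phi Z x y R ≤ 2 * L ^ 2 * Ker Z (wt R x y) x y 1 (1 / (R / L) ^ 2) + C * R ^ 12 := by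
  obtain ⟨C, hC, h⟩ := sum_wt
  refine ⟨π ^ 3 * C + π ^ 3 * C ^ 2 * (24 * (8 * (1 + L ^ 2)) ^ 4), by positivity, ?_⟩
  intro ι Z x y hs R hR
  have hL0 : 0 < L := by linarith
  have hR1 : 1 ≤ R := by linarith
  have hR0 : 0 < R := by linarith
  unfold Phi
  rw [Ker_HR _ _ _ _ hR0, Ker_HR _ _ _ _ (by positivity)]
  have hw := fun i => (wt_pos R x y i).le
  set ex := rexp (-(R ^ 2 / (8 * (1 + L ^ 2)))) with hex
  have hpt : ∀ i ∈ Z, ∀ j ∈ Z, wt R x y i * wt R x y j * HR R (x i - x j) (y i - y j) ≤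
      2 * L ^ 2 * (wt R x y i * wt R x y j * HR (R / L) (x i - x j) (y i - y j)) +
      (wt R x y i * wt R x y j * (π ^ 3 * R ^ 4 * ex) +
        (if i = j then π ^ 3 * R ^ 4 * wt R x y i else 0)) := by
    intro i hi j hj
    have hwij := mul_nonneg (hw i) (hw j)
    split_ifs with hij
    · have h1 := mul_le_mul_of_nonneg_left (HR_le R (x i - x j) (y i - y j)) hwij
      have h2 : wt R x y i * wt R x y j * (π ^ 3 * R ^ 4) ≤ π ^ 3 * R ^ 4 * wt R x y i := by
        have := mul_le_of_le_one_right (hw i) (wt_le_one R x y j)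
        have := mul_le_mul_of_nonneg_right this (show 0 ≤ π ^ 3 * R ^ 4 by positivity)
        linarith
      have h3 : 0 ≤ wt R x y i * wt R x y j * HR (R / L) (x i - x j) (y i - y j) :=
        mul_nonneg hwij (HR_nonneg _ _ _)
      have h4 : 0 ≤ wt R x y i * wt R x y j * (π ^ 3 * R ^ 4 * ex) := by positivity
      have h5 : 0 ≤ 2 * L ^ 2 * (wt R x y i * wt R x y j * HR (R / L) (x i - x j) (y i - y j)) := by
        positivity
      linarith
    · have h1 := mul_le_mul_of_nonneg_left (HR_case hL hR (x i - x j) (y i - y j)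
        (hs i hi j hj hij)) hwij
      linarith
  have hS := h Z x y hs R hR1
  have hS0 : 0 ≤ ∑ i ∈ Z, wt R x y i := Finset.sum_nonneg fun i _ => hw i
  calc _ ≤ ∑ i ∈ Z, ∑ j ∈ Z,
      (2 * L ^ 2 * (wt R x y i * wt R x y j * HR (R / L) (x i - x j) (y i - y j)) +
      (wt R x y i * wt R x y j * (π ^ 3 * R ^ 4 * ex) +
        (if i = j then π ^ 3 * R ^ 4 * wt R x y i else 0))) :=
        Finset.sum_le_sum fun i hi => Finset.sum_le_sum fun j hj => hpt i hi j hj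
    _ = 2 * L ^ 2 * (∑ i ∈ Z, ∑ j ∈ Z, wt R x y i * wt R x y j *
          HR (R / L) (x i - x j) (y i - y j)) +
        ((∑ i ∈ Z, wt R x y i) ^ 2 * (π ^ 3 * R ^ 4 * ex) +
          π ^ 3 * R ^ 4 * ∑ i ∈ Z, wt R x y i) := by
        simp_rw [Finset.sum_add_distrib]
        congr 1
        · simp_rw [Finset.mul_sum]
        congr 1
        · rw [sq, Finset.sum_mul_sum, Finset.sum_mul]
          refine Finset.sum_congr rfl fun i _ => ?_
          rw [Finset.sum_mul]
        · rw [Finset.mul_sum]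
          refine Finset.sum_congr rfl fun i hi => ?_
          rw [Finset.sum_ite_eq]; simp [hi]
    _ ≤ _ := by
        have a1 : π ^ 3 * R ^ 4 * ∑ i ∈ Z, wt R x y i ≤ π ^ 3 * C * R ^ 12 := by
          refine (mul_le_mul_of_nonneg_left hS (by positivity)).trans (le_of_eq ?_)
          ring
        have a2 : (∑ i ∈ Z, wt R x y i) ^ 2 ≤ (C * R ^ 8) ^ 2 := pow_le_pow_left₀ hS0 hS 2
        have a3 : ex ≤ 24 * (8 * (1 + L ^ 2)) ^ 4 / R ^ 8 := by
          refine (exp_dom (by positivity)).trans (le_of_eq ?_)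
          field_simp
        have a4 : (∑ i ∈ Z, wt R x y i) ^ 2 * (π ^ 3 * R ^ 4 * ex) ≤
            π ^ 3 * C ^ 2 * (24 * (8 * (1 + L ^ 2)) ^ 4) * R ^ 12 := by
          calc _ ≤ (C * R ^ 8) ^ 2 * (π ^ 3 * R ^ 4 * (24 * (8 * (1 + L ^ 2)) ^ 4 / R ^ 8)) := by
                apply mul_le_mul a2 _ (by positivity) (by positivity)
                exact mul_le_mul_of_nonneg_left a3 (by positivity)
            _ = _ := by field_simp
        linarith

lemma tele_sum {ι : Type*} (Z : Finset ι) (a : ι → ℝ) (ha : ∀ i, 0 ≤ a i) (x y : ι → C2)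
    (K A D η : ℝ) (hD : 0 ≤ D) (hη : 0 < η)
    (hT : ∀ k, 1 ≤ k → k ≤ K → TT Z a x y k ≤ ENNReal.ofReal (D * k ^ (2 + η)))
    (hl : ∀ k, 1 ≤ k → k ≤ 2 → Ker Z a x y 1 (1 / k ^ 2) ≤ A) (k0 : ℝ) (h1 : 1 ≤ k0) (h2 : k0 ≤ 2) :
    ∀ m : ℕ, 2 ^ m * k0 ≤ K →
      Ker Z a x y 1 (1 / (2 ^ m * k0) ^ 2) ≤ A + 4 * D * (2 ^ m * k0) ^ (2 + η) := by
  intro m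
  induction m with
  | zero =>
    intro _
    have := hl k0 h1 h2
    have : 0 ≤ 4 * D * (2 ^ 0 * k0) ^ (2 + η) := by positivity
    simp only [pow_zero, one_mul] at *
    linarith
  | succ m ih =>
    intro hm
    set k := 2 ^ m * k0 with hk
    have e : 2 ^ (m + 1) * k0 = 2 * k := by rw [hk, pow_succ]; ring
    rw [e] at hm ⊢
    have hk1 : 1 ≤ k := by
      have : (1 : ℝ) ≤ 2 ^ m := one_le_pow₀ (by norm_num)
      nlinarith
    have hk0 : 0 < k := by linarith
    have i1 := ih (by linarith)
    have t := telescope Z a x y k hk0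
    rw [Psi_eq _ _ _ _ (by norm_num) (by positivity), Psi_eq _ _ _ _ (by norm_num) (by positivity)] at t
    have t2 := t.trans (add_le_add le_rfl (mul_le_mul_right (hT (2 * k) (by linarith) hm) 3))
    rw [show (3 : ℝ≥0∞) = ENNReal.ofReal 3 by simp, ← ENNReal.ofReal_mul (by norm_num),
      ← ENNReal.ofReal_add (Ker_nonneg _ _ ha _ _ (by norm_num) (by positivity)) (by positivity),
      ENNReal.ofReal_le_ofReal_iff (add_nonneg (Ker_nonneg _ _ ha _ _ (by norm_num) (by positivity)) (by positivity))] at t2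
    have e2 : (2 * k) ^ (2 + η) = 2 ^ (2 + η) * k ^ (2 + η) := mul_rpow (by norm_num) hk0.le
    have e3 : (4 : ℝ) ≤ 2 ^ (2 + η) := by
      calc (4 : ℝ) = 2 ^ (2 : ℝ) := by norm_num
        _ ≤ _ := rpow_le_rpow_of_exponent_le (by norm_num) (by linarith)
    have e4 : 0 ≤ k ^ (2 + η) := by positivity
    have e5 : 4 * k ^ (2 + η) ≤ (2 * k) ^ (2 + η) := by
      rw [e2]; exact mul_le_mul_of_nonneg_right e3 e4
    have e6 := mul_le_mul_of_nonneg_left e5 hD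
    nlinarith

lemma Sep_shift {ι : Type*} {Z : Finset ι} {x y : ι → C2} (hs : Sep Z x y) (w : P8) :
    Sep Z (fun i => x i - w.ofLp.1) (fun i => √2 • (y i - w.ofLp.2)) := by
  intro i hi j hj hij
  have h := hs i hi j hj hij
  have e2 : √2 • (y i - w.ofLp.2) - √2 • (y j - w.ofLp.2) = √2 • (y i - y j) := by
    rw [← smul_sub]; congr 1; abel
  have e3 : x i - w.ofLp.1 - (x j - w.ofLp.1) = x i - x j := by abel
  simp only [e2, e3]
  rw [norm_smul, mul_pow, Real.norm_eq_abs, sq_abs, sq_sqrt (by norm_num)]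
  nlinarith [sq_nonneg ‖y i - y j‖]

theorem main_bound (η : ℝ) (hη : 0 < η) (hη1 : η ≤ 1) : ∃ C : ℝ, 0 < C ∧
    ∀ {ι : Type} (Z : Finset ι) (x y : ι → C2), Sep Z x y → ∀ R : ℝ, 1 ≤ R →
      Phi Z x y R ≤ C * R ^ (12 + η) := by
  obtain ⟨Ch, hCh, hhigh⟩ := high_part
  obtain ⟨Cl, hCl, hlow⟩ := low_part
  obtain ⟨Cc, hCc, hcrude⟩ := crude
  set L : ℝ := max 4 ((2 ^ 17 * Ch) ^ (1 / η)) with hLd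
  have hL4 : 4 ≤ L := le_max_left _ _
  have hL0 : 0 < L := by linarith
  have hLη : 2 ^ 17 * Ch ≤ L ^ η := by
    have h1 : (2 ^ 17 * Ch) ^ (1 / η) ≤ L := le_max_right _ _
    have := rpow_le_rpow (by positivity) h1 hη.le
    rwa [← rpow_mul (by positivity), one_div_mul_cancel hη.ne', rpow_one] at this
  obtain ⟨CA, hCA, hA⟩ := stepA L (by linarith)
  set C := max (2 * (2 * L ^ 2 * Cl + CA)) (Cc * (4 * L) ^ 8) with hCd
  have hC1 : 2 * (2 * L ^ 2 * Cl + CA) ≤ C := le_max_left _ _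
  have hC2 : Cc * (4 * L) ^ 8 ≤ C := le_max_right _ _
  have hC0 : 0 < C := lt_of_lt_of_le (by positivity) hC2
  refine ⟨C, hC0, ?_⟩
  have hR12 : ∀ R : ℝ, 1 ≤ R → R ^ 12 ≤ R ^ (12 + η) := by
    intro R hR
    calc R ^ 12 = R ^ (12 : ℝ) := by norm_cast
      _ ≤ _ := rpow_le_rpow_of_exponent_le hR (by linarith)
  have main : ∀ n : ℕ, ∀ {ι : Type} (Z : Finset ι) (x y : ι → C2), Sep Z x y → ∀ R : ℝ, 1 ≤ R →
      R ≤ 2 ^ n → Phi Z x y R ≤ C * R ^ (12 + η) := by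
    intro n
    induction n with
    | zero =>
      intro ι Z x y hs R hR hRn
      have : R = 1 := le_antisymm (by simpa using hRn) hR
      have h := hcrude Z x y hs R hR
      rw [this] at h ⊢
      simp only [one_pow, mul_one, one_rpow] at h ⊢
      have : Cc * 1 ≤ Cc * (4 * L) ^ 8 :=
        mul_le_mul_of_nonneg_left (one_le_pow₀ (by linarith)) hCc.le
      linarith
    | succ n ih =>
      intro ι Z x y hs R hR hRn
      have hR0 : 0 < R := by linarith
      by_cases hRL : R < 4 * L
      · have h := hcrude Z x y hs R hR
        have h8 : R ^ 8 ≤ (4 * L) ^ 8 := pow_le_pow_left₀ hR0.le hRL.le 8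
        calc Phi Z x y R ≤ Cc * R ^ 20 := h
          _ = Cc * R ^ 8 * R ^ 12 := by ring
          _ ≤ Cc * (4 * L) ^ 8 * R ^ (12 + η) := by
            apply mul_le_mul _ (hR12 R hR) (by positivity) (by positivity)
            exact mul_le_mul_of_nonneg_left h8 hCc.le
          _ ≤ _ := mul_le_mul_of_nonneg_right hC2 (by positivity)
      · push Not at hRL
        have hKd : R / L ≤ R / 4 := div_le_div_of_nonneg_left hR0.le (by norm_num) hL4
        have hK4 : 4 ≤ R / L := by rw [le_div_iff₀ hL0]; exact hRL
        -- high-frequency bounds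
        have hT : ∀ k, 1 ≤ k → k ≤ R / L → TT Z (wt R x y) x y k ≤
            ENNReal.ofReal ((Ch * 2 ^ 13 * C * R ^ 10) * k ^ (2 + η)) := by
          intro k hk1 hk2
          have hk0 : 0 < k := by linarith
          have h2k : 2 * k ≤ 2 ^ n := by
            rw [pow_succ] at hRn; linarith
          have hB := hhigh Z x y R k (C * (2 * k) ^ (12 + η)) hk1 (by linarith)
            (fun w => ih Z _ _ (Sep_shift hs w) (2 * k) (by linarith) h2k)
          refine hB.trans (ENNReal.ofReal_le_ofReal ?_)
          have e1 : (2 * k) ^ (12 + η) = 2 ^ (12 + η) * k ^ (12 + η) :=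
            mul_rpow (by norm_num) hk0.le
          have e2 : k ^ (12 + η) = k ^ 10 * k ^ (2 + η) := by
            rw [← rpow_natCast k 10, ← rpow_add hk0]; congr 1; push_cast; ring
          have e3 : (2 : ℝ) ^ (12 + η) ≤ 2 ^ 13 := by
            calc (2 : ℝ) ^ (12 + η) ≤ 2 ^ (13 : ℝ) :=
                  rpow_le_rpow_of_exponent_le (by norm_num) (by linarith)
              _ = _ := by norm_num
          rw [e1, e2]
          calc _ = (Ch * C * R ^ 10 * k ^ (2 + η)) * 2 ^ (12 + η) := by field_simp
            _ ≤ (Ch * C * R ^ 10 * k ^ (2 + η)) * 2 ^ 13 :=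
              mul_le_mul_of_nonneg_left e3 (by positivity)
            _ = _ := by ring
        obtain ⟨m, hm1, hm2⟩ := exists_nat_pow_near (x := R / L) (y := 2) (by linarith) (by norm_num)
        have hp : (0 : ℝ) < 2 ^ m := by positivity
        have hk0e : 2 ^ m * (R / L / 2 ^ m) = R / L := by field_simp
        have ht := tele_sum Z (wt R x y) (fun i => (wt_pos R x y i).le) x y (R / L) (Cl * R ^ 12)
          (Ch * 2 ^ 13 * C * R ^ 10) η (by positivity) hη hT
          (fun k h1 h2 => hlow Z x y hs R k hR h1 h2) (R / L / 2 ^ m)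
          (by rw [le_div_iff₀ hp]; linarith)
          (by rw [div_le_iff₀ hp]; rw [pow_succ] at hm2; linarith) m hk0e.le
        rw [hk0e] at ht
        have hfin := hA Z x y hs R hRL
        have e1 : (R / L) ^ (2 + η) = R ^ (2 + η) / (L ^ 2 * L ^ η) := by
          rw [div_rpow hR0.le hL0.le, rpow_add hL0]
          norm_num
        have e2 : R ^ (12 + η) = R ^ 10 * R ^ (2 + η) := by
          rw [← rpow_natCast R 10, ← rpow_add hR0]; congr 1; push_cast; ring
        have hLp : 0 < L ^ η := by positivity
        have e3 : 2 * L ^ 2 * (4 * (Ch * 2 ^ 13 * C * R ^ 10) * (R / L) ^ (2 + η)) ≤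
            C / 2 * R ^ (12 + η) := by
          rw [e1, e2]
          calc _ = (2 ^ 17 * Ch) / L ^ η * (C / 2 * (R ^ 10 * R ^ (2 + η))) := by
                field_simp; ring
            _ ≤ 1 * (C / 2 * (R ^ 10 * R ^ (2 + η))) := by
                apply mul_le_mul_of_nonneg_right _ (by positivity)
                rw [div_le_one hLp]; exact hLη
            _ = _ := one_mul _
        have e4 := mul_le_mul_of_nonneg_left ht (show 0 ≤ 2 * L ^ 2 by positivity)
        have e5 : (2 * L ^ 2 * Cl + CA) * R ^ 12 ≤ C / 2 * R ^ (12 + η) :=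
          mul_le_mul (by linarith) (hR12 R hR) (by positivity) (by positivity)
        linarith
  intro ι Z x y hs R hR
  obtain ⟨n, hn⟩ := pow_unbounded_of_one_lt R (show (1 : ℝ) < 2 by norm_num)
  exact main n Z x y hs R hR hn.le

end Aux

namespace Aux
open MeasureTheory Real
open scoped RealInnerProductSpace ENNReal

/-- isotropic coordinates on `ℂ²` -/
def uu (p : C2) : ℂ := p 0 + Complex.I * p 1
def vv (p : C2) : ℂ := p 0 - Complex.I * p 1

lemma uu_sub (p q : C2) : uu (p - q) = uu p - uu q := by
  simp only [uu, PiLp.sub_apply]; ring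
lemma vv_sub (p q : C2) : vv (p - q) = vv p - vv q := by
  simp only [vv, PiLp.sub_apply]; ring
lemma cDelta_eq (p q : C2) : cDelta p q = (uu p - uu q) * (vv p - vv q) := by
  simp only [cDelta, uu, vv]
  linear_combination ((p 1 - q 1) ^ 2) * Complex.I_sq
lemma uv_norm (p : C2) : ‖uu p‖ ^ 2 + ‖vv p‖ ^ 2 = 2 * ‖p‖ ^ 2 := by
  simp only [EuclideanSpace.norm_sq_eq, Fin.sum_univ_two, uu, vv, Complex.sq_norm,
    Complex.normSq_apply]
  simp
  ring
lemma uv_norm_sub (p q : C2) : ‖uu p - uu q‖ ^ 2 + ‖vv p - vv q‖ ^ 2 = 2 * ‖p - q‖ ^ 2 := by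
  rw [← uu_sub, ← vv_sub, uv_norm]


lemma uv_le {p : C2} {W : ℝ} (h : ‖p‖ ≤ W) : ‖uu p‖ ≤ 2 * W ∧ ‖vv p‖ ≤ 2 * W := by
  have h0 := norm_nonneg p
  have := uv_norm p
  have h1 : ‖p‖ ^ 2 ≤ W ^ 2 := pow_le_pow_left₀ h0 h 2
  constructor
  · apply abs_le_of_sq_le_sq' _ (by linarith) |>.2
    nlinarith [sq_nonneg ‖vv p‖]
  · apply abs_le_of_sq_le_sq' _ (by linarith) |>.2
    nlinarith [sq_nonneg ‖uu p‖]

lemma card_Icc_floor (a b : ℝ) (h : a ≤ b) :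
    ((Finset.Icc ⌊a⌋ ⌊b⌋).card : ℝ) ≤ b - a + 2 := by
  rw [Int.card_Icc]
  have h1 := Int.floor_mono h
  have : (((⌊b⌋ + 1 - ⌊a⌋).toNat : ℤ) : ℝ) = ⌊b⌋ + 1 - ⌊a⌋ := by
    rw [Int.toNat_of_nonneg (by omega)]; push_cast; ring
  have h2 := Int.floor_le b
  have h3 := Int.lt_floor_add_one a
  push_cast at this
  rw [this]
  linarith

lemma floor_close {a b : ℝ} (h : ⌊2 * a⌋ = ⌊2 * b⌋) : (a - b) ^ 2 < 1 / 4 := by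
  have h1 := Int.abs_sub_lt_one_of_floor_eq_floor h
  rw [abs_lt] at h1
  nlinarith

/-- few points near a complex line -/
lemma near_line (A : Finset C2) (W d : ℝ) (hd : 0 ≤ d) (hW : 0 ≤ W)
    (hsep : ∀ p ∈ A, ∀ q ∈ A, p ≠ q → 1 ≤ ‖p - q‖) (hb : ∀ p ∈ A, ‖p‖ ≤ W) (z : ℂ) :
    ((A.filter fun p => ‖z - uu p‖ < d).card : ℝ) ≤ (4 * d + 2) ^ 2 * (8 * W + 2) ^ 2 := by
  let I1 := Finset.Icc ⌊2 * z.re - 2 * d⌋ ⌊2 * z.re + 2 * d⌋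
  let I2 := Finset.Icc ⌊2 * z.im - 2 * d⌋ ⌊2 * z.im + 2 * d⌋
  let I3 := Finset.Icc ⌊-(4 * W)⌋ ⌊4 * W⌋
  have key : (A.filter fun p => ‖z - uu p‖ < d).card ≤ (I1 ×ˢ I2 ×ˢ I3 ×ˢ I3).card := by
    apply Finset.card_le_card_of_injOn (fun p => (⌊2 * (uu p).re⌋, ⌊2 * (uu p).im⌋,
      ⌊2 * (vv p).re⌋, ⌊2 * (vv p).im⌋))
    · intro p hp
      simp only [Finset.coe_filter, Set.mem_setOf_eq] at hp
      obtain ⟨hp, hz⟩ := hp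
      have a1 := abs_le.1 ((Complex.abs_re_le_norm (z - uu p)).trans hz.le)
      have a2 := abs_le.1 ((Complex.abs_im_le_norm (z - uu p)).trans hz.le)
      have h2 := (uv_le (hb p hp)).2
      have a3 := abs_le.1 ((Complex.abs_re_le_norm (vv p)).trans h2)
      have a4 := abs_le.1 ((Complex.abs_im_le_norm (vv p)).trans h2)
      simp only [Complex.sub_re, Complex.sub_im] at a1 a2
      simp only [I1, I2, I3, Finset.coe_product, Set.mem_prod, Finset.coe_Icc, Set.mem_Icc]
      refine ⟨⟨?_, ?_⟩, ⟨?_, ?_⟩, ⟨?_, ?_⟩, ?_, ?_⟩ <;> apply Int.floor_mono <;> linarith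
    · intro p hp q hq h
      simp only [Finset.coe_filter, Set.mem_setOf_eq] at hp hq
      simp only [Prod.mk.injEq] at h
      obtain ⟨e1, e2, e3, e4⟩ := h
      by_contra hne
      have h1 := hsep p hp.1 q hq.1 hne
      have h2 := uv_norm_sub p q
      rw [Complex.sq_norm, Complex.sq_norm, Complex.normSq_apply, Complex.normSq_apply] at h2
      simp only [Complex.sub_re, Complex.sub_im] at h2
      have := floor_close e1
      have := floor_close e2
      have := floor_close e3
      have := floor_close e4
      nlinarith
  have key2 : ((A.filter fun p => ‖z - uu p‖ < d).card : ℝ) ≤ (I1 ×ˢ I2 ×ˢ I3 ×ˢ I3).card := by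
    exact_mod_cast key
  refine key2.trans ?_
  rw [Finset.card_product, Finset.card_product, Finset.card_product]
  push_cast
  have c1 : (I1.card : ℝ) ≤ 4 * d + 2 :=
    (card_Icc_floor _ _ (by linarith)).trans (by linarith)
  have c2 : (I2.card : ℝ) ≤ 4 * d + 2 :=
    (card_Icc_floor _ _ (by linarith)).trans (by linarith)
  have c3 : (I3.card : ℝ) ≤ 8 * W + 2 :=
    (card_Icc_floor _ _ (by linarith)).trans (by linarith)
  calc (I1.card : ℝ) * (I2.card * (I3.card * I3.card))
      ≤ (4 * d + 2) * ((4 * d + 2) * ((8 * W + 2) * (8 * W + 2))) := by gcongr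
    _ = _ := by ring

/-- Cauchy-Schwarz over fibres -/
lemma fibre_cs {α : Type*} (G : Finset α) (T : Finset ℂ) (f : α → ℂ) (hf : ∀ g ∈ G, f g ∈ T) :
    (G.card : ℝ) ^ 2 ≤ T.card * ∑ g ∈ G, ∑ h ∈ G, (if f g = f h then (1:ℝ) else 0) := by
  have h1 : (G.card : ℝ) = ∑ t ∈ T, ∑ g ∈ G, (if f g = t then (1:ℝ) else 0) := by
    rw [Finset.sum_comm]
    rw [Finset.sum_congr rfl (g := fun _ => (1:ℝ))]
    · simp
    · intro g hg
      rw [Finset.sum_ite_eq, if_pos (hf g hg)]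
  rw [h1]
  refine (sq_sum_le_card_mul_sum_sq).trans ?_
  gcongr
  simp_rw [sq, Finset.sum_mul_sum]
  rw [Finset.sum_comm]
  apply Finset.sum_le_sum
  intro g _
  rw [Finset.sum_comm]
  apply Finset.sum_le_sum
  intro h _
  have : ∀ t, (if f g = t then (1:ℝ) else 0) * (if f h = t then (1:ℝ) else 0) =
      if f g = t then (if f h = f g then 1 else 0) else 0 := by
    intro t
    by_cases h1 : f g = t
    · subst h1; simp
    · simp [h1]
  simp_rw [this]
  rw [Finset.sum_ite_eq]
  by_cases h1 : f g = f h
  · simp [h1]; split_ifs <;> norm_num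
  · simp [h1, Ne.symm h1]

def xx (i : C2 × C2) : C2 := !₂[uu i.2, -vv i.1]
def yy (i : C2 × C2) : C2 := !₂[-uu i.1, vv i.2]

lemma xx_norm (i j : C2 × C2) : ‖xx i - xx j‖ ^ 2 = ‖uu i.2 - uu j.2‖ ^ 2 + ‖vv i.1 - vv j.1‖ ^ 2 := by
  rw [EuclideanSpace.norm_sq_eq, Fin.sum_univ_two]
  simp only [xx, PiLp.sub_apply, PiLp.toLp_apply, Matrix.cons_val_zero, Matrix.cons_val_one]
  rw [show -vv i.1 - -vv j.1 = -(vv i.1 - vv j.1) by ring, norm_neg]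
lemma yy_norm (i j : C2 × C2) : ‖yy i - yy j‖ ^ 2 = ‖uu i.1 - uu j.1‖ ^ 2 + ‖vv i.2 - vv j.2‖ ^ 2 := by
  rw [EuclideanSpace.norm_sq_eq, Fin.sum_univ_two]
  simp only [yy, PiLp.sub_apply, PiLp.toLp_apply, Matrix.cons_val_zero, Matrix.cons_val_one]
  rw [show -uu i.1 - -uu j.1 = -(uu i.1 - uu j.1) by ring, norm_neg]
lemma xy_norm (i : C2 × C2) : ‖xx i‖ ^ 2 + ‖yy i‖ ^ 2 = 2 * ‖i.1‖ ^ 2 + 2 * ‖i.2‖ ^ 2 := by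
  rw [EuclideanSpace.norm_sq_eq, EuclideanSpace.norm_sq_eq, Fin.sum_univ_two, Fin.sum_univ_two]
  simp only [xx, yy, PiLp.toLp_apply, Matrix.cons_val_zero, Matrix.cons_val_one, norm_neg]
  rw [← uv_norm, ← uv_norm]
  ring
lemma xy_qf (i j : C2 × C2) :
    qf (xx i - xx j) (yy i - yy j) = cDelta i.2 j.2 - cDelta i.1 j.1 := by
  rw [cDelta_eq, cDelta_eq]
  simp only [qf, xx, yy, PiLp.sub_apply, PiLp.toLp_apply, Matrix.cons_val_zero, Matrix.cons_val_one]
  ring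

lemma xy_sep (A : Finset C2) (hsep : ∀ p ∈ A, ∀ q ∈ A, p ≠ q → 1 ≤ ‖p - q‖) :
    Sep (A ×ˢ A) xx yy := by
  intro i hi j hj hij
  rw [Finset.mem_product] at hi hj
  rw [xx_norm, yy_norm]
  have h1 := uv_norm_sub i.1 j.1
  have h2 := uv_norm_sub i.2 j.2
  by_cases h : i.1 = j.1
  · have h' : i.2 ≠ j.2 := fun h' => hij (Prod.ext h h')
    have := hsep _ hi.2 _ hj.2 h'
    nlinarith [sq_nonneg ‖i.1 - j.1‖]
  · have := hsep _ hi.1 _ hj.1 h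
    nlinarith [sq_nonneg ‖i.2 - j.2‖]

/-- lower bound for the kernel -/
lemma HR_lower {W : ℝ} (hW : 480 ≤ W) (a b : C2) (ha : ‖a‖ ^ 2 ≤ 16 * W ^ 2)
    (hb : ‖b‖ ^ 2 ≤ 16 * W ^ 2) (hb' : (W / 480) ^ 2 ≤ ‖b‖ ^ 2) (hq : ‖qf a b‖ ≤ 8) :
    rexp (-(32 * 480 ^ 2)) ≤ HR W a b := by
  have hW0 : 0 < W := by linarith
  have hq2 : ‖qf a b‖ ^ 2 ≤ 64 := by nlinarith [norm_nonneg (qf a b)]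
  unfold HR HH
  have hD : 0 < 1 + W ^ 2 / 4 * ‖b‖ ^ 2 := by positivity
  have e1 : rexp (-(32 * 480 ^ 2)) ≤ rexp (-(1 * (W ^ 2 / 4) * ‖a‖ ^ 2 +
      (W ^ 2 / 4) ^ 2 * ‖qf a b‖ ^ 2) / (1 + W ^ 2 / 4 * ‖b‖ ^ 2)) := by
    apply exp_le_exp.2
    rw [neg_div, neg_le_neg_iff, div_le_iff₀ hD]
    have h1 := mul_le_mul_of_nonneg_left ha (by positivity : 0 ≤ W ^ 2 / 4)
    have h2 := mul_le_mul_of_nonneg_left hq2 (by positivity : 0 ≤ (W ^ 2 / 4) ^ 2)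
    have h3 := mul_le_mul_of_nonneg_left hb' (by positivity : 0 ≤ W ^ 2 / 4)
    nlinarith
  have e2 : 1 ≤ (π * W ^ 2) ^ 2 * (π / (1 + W ^ 2 / 4 * ‖b‖ ^ 2)) := by
    rw [← mul_div_assoc, le_div_iff₀ hD]
    have h2 := mul_le_mul_of_nonneg_left hb (by positivity : 0 ≤ W ^ 2 / 4)
    have h3 : (27:ℝ) ≤ π ^ 3 := by
      have := pow_le_pow_left₀ (by norm_num) pi_gt_three.le 3
      linarith
    have h4 : 1 ≤ W ^ 4 := one_le_pow₀ (by linarith)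
    have h5 := mul_le_mul_of_nonneg_right h3 (by positivity : 0 ≤ W ^ 4)
    nlinarith
  calc rexp (-(32 * 480 ^ 2)) = 1 * rexp (-(32 * 480 ^ 2)) := by ring
    _ ≤ _ := mul_le_mul e2 e1 (exp_pos _).le (by positivity)
    _ = _ := by ring

end Aux

namespace Aux
open MeasureTheory Real
open scoped RealInnerProductSpace ENNReal

lemma sub_sq_le {p q : C2} {W : ℝ} (hp : ‖p‖ ≤ W) (hq : ‖q‖ ≤ W) : ‖p - q‖ ^ 2 ≤ 4 * W ^ 2 := by
  have h := (norm_sub_le p q).trans (add_le_add hp hq)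
  have := pow_le_pow_left₀ (norm_nonneg _) h 2
  nlinarith

/-- the set of good pairs is large -/
lemma good_card (A : Finset C2) {W : ℝ} (hW : 480 ≤ W)
    (hsep : ∀ p ∈ A, ∀ q ∈ A, p ≠ q → 1 ≤ ‖p - q‖) (hb : ∀ p ∈ A, ‖p‖ ≤ W)
    (hA : W ^ 4 / 32 ≤ A.card) :
    (A.card : ℝ) ^ 2 / 2 ≤ (((A ×ˢ A).filter fun g => W / 480 ≤ ‖uu g.1 - uu g.2‖).card : ℝ) := by
  have h1 : (((A ×ˢ A).filter fun g => W / 480 ≤ ‖uu g.1 - uu g.2‖).card : ℝ) =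
      ∑ p ∈ A, ((A.filter fun q => W / 480 ≤ ‖uu p - uu q‖).card : ℝ) := by
    simp only [Finset.card_filter]
    push_cast
    rw [Finset.sum_product]
  rw [h1]
  have h2 : ∀ p ∈ A, (A.card : ℝ) / 2 ≤ ((A.filter fun q => W / 480 ≤ ‖uu p - uu q‖).card : ℝ) := by
    intro p _
    have h3 := near_line A W (W / 480) (by positivity) (by linarith) hsep hb (uu p)
    have h4 := Finset.card_filter_add_card_filter_not (s := A) (fun q => W / 480 ≤ ‖uu p - uu q‖)
    simp only [not_le] at h4
    have h5 : ((A.filter fun q => W / 480 ≤ ‖uu p - uu q‖).card : ℝ) +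
      ((A.filter fun q => ‖uu p - uu q‖ < W / 480).card : ℝ) = A.card := by exact_mod_cast h4
    have h6 : (4 * (W / 480) + 2) ^ 2 * (8 * W + 2) ^ 2 ≤ (6 * (W / 480)) ^ 2 * (10 * W) ^ 2 := by
      gcongr <;> linarith
    nlinarith
  calc (A.card : ℝ) ^ 2 / 2 = ∑ p ∈ A, (A.card : ℝ) / 2 := by
        rw [Finset.sum_const, nsmul_eq_mul]; ring
    _ ≤ _ := Finset.sum_le_sum h2

/-- the scaled form of the result -/
theorem scaled (η : ℝ) (hη : 0 < η) (hη1 : η ≤ 1) : ∃ c : ℝ, 0 < c ∧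
    ∀ (A : Finset C2) (W : ℝ), 480 ≤ W →
    (∀ p ∈ A, ∀ q ∈ A, p ≠ q → 1 ≤ ‖p - q‖) → (∀ p ∈ A, ‖p‖ ≤ W) → W ^ 4 / 32 ≤ A.card →
    ∀ (T : Finset ℂ) (f : C2 × C2 → ℂ), (∀ g ∈ A ×ˢ A, f g ∈ T) →
    (∀ g ∈ A ×ˢ A, ∀ h ∈ A ×ˢ A, f g = f h → ‖cDelta h.1 h.2 - cDelta g.1 g.2‖ ≤ 8) →
    c * W ^ (4 - η) ≤ T.card := by
  obtain ⟨C, hC, hmain⟩ := main_bound η hη hη1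
  refine ⟨rexp (-8 - 32 * 480 ^ 2) / (C * 2048 ^ 2), by positivity, ?_⟩
  intro A W hW hsep hb hA T f hfT hf
  have hW0 : 0 < W := by linarith
  set c0 := rexp (-8 - 32 * 480 ^ 2) with hc0
  have hc0p : 0 < c0 := exp_pos _
  set G := (A ×ˢ A).filter fun g => W / 480 ≤ ‖uu g.1 - uu g.2‖ with hG
  have hGc : (A.card : ℝ) ^ 2 / 2 ≤ (G.card : ℝ) := good_card A hW hsep hb hA
  have hcs := fibre_cs G T f (fun g hg => hfT g (Finset.mem_filter.1 hg).1)
  have hPhi := hmain (A ×ˢ A) xx yy (xy_sep A hsep) W (by linarith)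
  -- the main comparison
  let t : C2 × C2 → C2 × C2 → ℝ := fun i j =>
    wt W xx yy i * wt W xx yy j * HR W (xx i - xx j) (yy i - yy j)
  have ht : ∀ i j, 0 ≤ t i j := fun i j =>
    mul_nonneg (mul_nonneg (wt_pos _ _ _ _).le (wt_pos _ _ _ _).le) (HR_nonneg _ _ _)
  have hP : Phi (A ×ˢ A) xx yy W = ∑ g ∈ A ×ˢ A, ∑ h ∈ A ×ˢ A, t (g.1, h.1) (g.2, h.2) := by
    unfold Phi
    rw [Ker_HR _ _ _ _ hW0]
    rw [Finset.sum_product, Finset.sum_product]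
    apply Finset.sum_congr rfl
    intro p1 _
    simp only [Finset.sum_product]
    rw [Finset.sum_comm]
  have hwt : ∀ i ∈ A ×ˢ A, rexp (-4) ≤ wt W xx yy i := by
    intro i hi
    rw [Finset.mem_product] at hi
    unfold wt
    apply exp_le_exp.2
    rw [xy_norm, neg_div, neg_le_neg_iff, div_le_iff₀ (by positivity)]
    have h1 := pow_le_pow_left₀ (norm_nonneg _) (hb _ hi.1) 2
    have h2 := pow_le_pow_left₀ (norm_nonneg _) (hb _ hi.2) 2
    linarith
  have hterm : ∀ g ∈ G, ∀ h ∈ G, f g = f h → c0 ≤ t (g.1, h.1) (g.2, h.2) := by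
    intro g hg h hh hfe
    obtain ⟨hgA, hgu⟩ := Finset.mem_filter.1 hg
    obtain ⟨hhA, hhu⟩ := Finset.mem_filter.1 hh
    have hq := hf g hgA h hhA hfe
    rw [Finset.mem_product] at hgA hhA
    have hw1 := hwt (g.1, h.1) (Finset.mem_product.2 ⟨hgA.1, hhA.1⟩)
    have hw2 := hwt (g.2, h.2) (Finset.mem_product.2 ⟨hgA.2, hhA.2⟩)
    have s1 := sub_sq_le (hb _ hgA.1) (hb _ hgA.2)
    have s2 := sub_sq_le (hb _ hhA.1) (hb _ hhA.2)
    have n1 := uv_norm_sub g.1 g.2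
    have n2 := uv_norm_sub h.1 h.2
    have hH := HR_lower hW (xx (g.1, h.1) - xx (g.2, h.2)) (yy (g.1, h.1) - yy (g.2, h.2))
      (by
        rw [xx_norm]; dsimp only
        nlinarith [sq_nonneg ‖uu g.1 - uu g.2‖, sq_nonneg ‖vv h.1 - vv h.2‖])
      (by
        rw [yy_norm]; dsimp only
        nlinarith [sq_nonneg ‖vv g.1 - vv g.2‖, sq_nonneg ‖uu h.1 - uu h.2‖])
      (by
        rw [yy_norm]; dsimp only
        have := pow_le_pow_left₀ (by positivity) hgu 2
        nlinarith [sq_nonneg ‖vv h.1 - vv h.2‖])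
      (by rw [xy_qf]; exact hq)
    have e : c0 = rexp (-4) * rexp (-4) * rexp (-(32 * 480 ^ 2)) := by
      rw [hc0, ← exp_add, ← exp_add]; congr 1; norm_num
    rw [e]
    have := (wt_pos W xx yy (g.1, h.1)).le
    have := (wt_pos W xx yy (g.2, h.2)).le
    exact mul_le_mul (mul_le_mul hw1 hw2 (exp_pos _).le (by assumption)) hH (exp_pos _).le
      (by positivity)
  have hcmp : c0 * ∑ g ∈ G, ∑ h ∈ G, (if f g = f h then (1:ℝ) else 0) ≤ Phi (A ×ˢ A) xx yy W := by
    rw [hP, Finset.mul_sum]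
    have hGs : G ⊆ A ×ˢ A := Finset.filter_subset _ _
    refine le_trans ?_ (Finset.sum_le_sum_of_subset_of_nonneg hGs
      (fun g _ _ => Finset.sum_nonneg fun h _ => ht _ _))
    apply Finset.sum_le_sum
    intro g hg
    rw [Finset.mul_sum]
    refine le_trans ?_ (Finset.sum_le_sum_of_subset_of_nonneg hGs (fun h _ _ => ht _ _))
    apply Finset.sum_le_sum
    intro h hh
    split_ifs with hfe
    · rw [mul_one]; exact hterm g hg h hh hfe
    · rw [mul_zero]; exact ht _ _
  set S := ∑ g ∈ G, ∑ h ∈ G, (if f g = f h then (1:ℝ) else 0) with hS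
  have hT0 : (0:ℝ) ≤ T.card := Nat.cast_nonneg _
  have hA2 : (W ^ 4 / 32) ^ 2 ≤ (A.card : ℝ) ^ 2 := pow_le_pow_left₀ (by positivity) hA 2
  have hG2 : W ^ 8 / 2048 ≤ G.card := by
    refine le_trans ?_ hGc
    nlinarith
  have hG3 : (W ^ 8 / 2048) ^ 2 ≤ (G.card : ℝ) ^ 2 := pow_le_pow_left₀ (by positivity) hG2 2
  have h9 : c0 * (W ^ 8 / 2048) ^ 2 ≤ T.card * (C * W ^ (12 + η)) := by
    calc c0 * (W ^ 8 / 2048) ^ 2 ≤ c0 * (T.card * S) :=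
          mul_le_mul_of_nonneg_left (hG3.trans hcs) hc0p.le
      _ = T.card * (c0 * S) := by ring
      _ ≤ _ := mul_le_mul_of_nonneg_left (hcmp.trans hPhi) hT0
  have h10 : W ^ (4 - η) * W ^ (12 + η) = W ^ 16 := by
    rw [← rpow_add hW0, ← rpow_natCast]; congr 1; push_cast; ring
  have hp : 0 < W ^ (12 + η) := rpow_pos_of_pos hW0 _
  rw [div_mul_eq_mul_div, div_le_iff₀ (by positivity)]
  apply le_of_mul_le_mul_right _ hp
  calc c0 * W ^ (4 - η) * W ^ (12 + η) = c0 * (W ^ 4 ^ 2) := by rw [mul_assoc, h10]; ring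
    _ = c0 * (W ^ 8 / 2048) ^ 2 * 2048 ^ 2 := by ring
    _ ≤ T.card * (C * W ^ (12 + η)) * 2048 ^ 2 := by gcongr
    _ = _ := by ring

end Aux

namespace Aux
open MeasureTheory Real

lemma max_sep (E : Finset C2) (ρ : ℝ) (hρ : 0 < ρ) : ∃ A ⊆ E,
    (∀ p ∈ A, ∀ q ∈ A, p ≠ q → ρ ≤ ‖p - q‖) ∧ ∀ e ∈ E, ∃ a ∈ A, ‖e - a‖ < ρ := by
  obtain ⟨A, hA, hmax⟩ := Finset.exists_max_image
    (E.powerset.filter fun A => ∀ p ∈ A, ∀ q ∈ A, p ≠ q → ρ ≤ ‖p - q‖) Finset.card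
    ⟨∅, by simp⟩
  rw [Finset.mem_filter, Finset.mem_powerset] at hA
  refine ⟨A, hA.1, hA.2, ?_⟩
  intro e he
  by_contra hcon
  push Not at hcon
  have hne : e ∉ A := by
    intro h
    have := hcon e h
    simp at this
    linarith
  have := hmax (insert e A) (by
    rw [Finset.mem_filter, Finset.mem_powerset]
    refine ⟨Finset.insert_subset he hA.1, ?_⟩
    intro p hp q hq hpq
    rw [Finset.mem_insert] at hp hq
    rcases hp with rfl | hp <;> rcases hq with rfl | hq
    · exact absurd rfl hpq
    · exact hcon q hq
    · rw [norm_sub_rev]; exact hcon p hp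
    · exact hA.2 p hp q hq hpq)
  rw [Finset.card_insert_of_notMem hne] at this
  omega

lemma cDelta_smul (w : ℝ) (p q : C2) : cDelta (w • p) (w • q) = (w:ℂ) ^ 2 * cDelta p q := by
  simp only [cDelta, PiLp.smul_apply, Complex.real_smul]
  ring

theorem final (s ε : ℝ) (hs₁ : 1 < s) (hs₂ : s < 2) (hε : 0 < ε) :
    ∃ c δ₀ : ℝ, 0 < c ∧ 0 < δ₀ ∧
      ∀ δ : ℝ, 0 < δ → δ < δ₀ →
      ∀ N : ℝ, 1 ≤ N →
      ∀ E : Finset C2,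
        (∀ x ∈ E, closedBall x δ ⊆ closedBall (0 : C2) 1) →
        (1 / 2 * N * δ ^ (-s) ≤ (E.card : ℝ)) →
        (∀ z : C2,
          ((E.filter fun x => closedBall x δ ⊆ closedBall z (δ ^ (s / 4))).card : ℝ) ≤ N) →
        ∀ S : Finset ℂ, diffSet E δ ⊆ (⋃ z ∈ S, closedBall z δ) →
          c * δ ^ (-s + ε) ≤ (S.card : ℝ) := by
  obtain ⟨c, hc, hsc⟩ := scaled (min 1 ε) (lt_min one_pos hε) (min_le_left _ _)
  set η := min 1 ε with hη
  have hη0 : 0 < η := lt_min one_pos hε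
  have hη1 : η ≤ 1 := min_le_left _ _
  have hηε : η ≤ ε := min_le_right _ _
  refine ⟨c, (1 / 240) ^ 4, hc, by positivity, ?_⟩
  intro δ hδ hδ0 N hN E hE hcard hball S hS
  have hδ1 : δ < 1 := hδ0.trans (by norm_num)
  set r := δ ^ (s / 4) with hr
  have hr0 : 0 < r := rpow_pos_of_pos hδ _
  -- smallness of `r`
  have hq : δ ^ ((1:ℝ) / 4) ≤ 1 / 240 := by
    have : δ ^ ((1:ℝ) / 4) ≤ ((1 / 240 : ℝ) ^ 4) ^ ((1:ℝ) / 4) :=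
      rpow_le_rpow hδ.le hδ0.le (by norm_num)
    refine this.trans (le_of_eq ?_)
    rw [← rpow_natCast, ← rpow_mul (by norm_num)]
    norm_num
  have hr1 : r ≤ 1 / 240 := le_trans
    (rpow_le_rpow_of_exponent_ge hδ hδ1.le (by linarith)) hq
  have hδr : δ ≤ r / 2 := by
    have h1 : δ = r * δ ^ (1 - s / 4) := by
      rw [hr, ← rpow_add hδ]; simp
    have h2 : δ ^ (1 - s / 4) ≤ 1 / 240 :=
      le_trans (rpow_le_rpow_of_exponent_ge hδ hδ1.le (by linarith)) hq
    nlinarith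
  have hδr2 : δ ≤ r ^ 2 := by
    rw [hr, ← rpow_natCast, ← rpow_mul hδ.le]
    have := rpow_le_rpow_of_exponent_ge hδ hδ1.le (y := 1) (z := s / 4 * (2:ℕ))
      (by push_cast; linarith)
    rwa [rpow_one] at this
  have hr4 : (r ^ 4)⁻¹ = δ ^ (-s) := by
    rw [hr, ← rpow_natCast, ← rpow_mul hδ.le, ← rpow_neg hδ.le]
    congr 1; push_cast; ring
  obtain ⟨A, hAE, hsep, hcov⟩ := max_sep E (r / 2) (by positivity)
  -- counting
  have hAc : (E.card : ℝ) ≤ A.card * N := by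
    have h1 : E ⊆ A.biUnion fun a => E.filter fun x => closedBall x δ ⊆ closedBall a r := by
      intro e he
      obtain ⟨a, ha, hea⟩ := hcov e he
      rw [Finset.mem_biUnion]
      refine ⟨a, ha, Finset.mem_filter.2 ⟨he, ?_⟩⟩
      apply closedBall_subset_closedBall'
      rw [dist_eq_norm]
      linarith
    have h2 := (Finset.card_le_card h1).trans Finset.card_biUnion_le
    calc (E.card : ℝ) ≤ ((∑ a ∈ A, (E.filter fun x => closedBall x δ ⊆ closedBall a r).card : ℕ) : ℝ) := by
          exact_mod_cast h2
      _ = ∑ a ∈ A, ((E.filter fun x => closedBall x δ ⊆ closedBall a r).card : ℝ) := by push_cast; rfl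
      _ ≤ ∑ a ∈ A, N := Finset.sum_le_sum fun a _ => hball a
      _ = _ := by rw [Finset.sum_const, nsmul_eq_mul]
  have hAc2 : 1 / 2 * δ ^ (-s) ≤ A.card := by
    have h0 : 0 < N := by linarith
    apply le_of_mul_le_mul_right _ h0
    linarith
  set W := 2 / r with hW
  have hW0 : 0 < W := by positivity
  have hW480 : 480 ≤ W := by
    rw [hW, le_div_iff₀ hr0]; linarith
  have hinj : Function.Injective (fun p : C2 => W • p) := smul_right_injective _ hW0.ne'
  have hcardA : (A.image fun p : C2 => W • p).card = A.card := Finset.card_image_of_injective _ hinj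
  -- the colouring
  have hex : ∀ g : C2 × C2, ∃ z : ℂ, cDelta (W⁻¹ • g.1) (W⁻¹ • g.2) ∈ diffSet E δ →
      z ∈ S ∧ ‖cDelta (W⁻¹ • g.1) (W⁻¹ • g.2) - z‖ ≤ δ := by
    intro g
    by_cases h : cDelta (W⁻¹ • g.1) (W⁻¹ • g.2) ∈ diffSet E δ
    · have := hS h
      simp only [Set.mem_iUnion, mem_closedBall, dist_eq_norm] at this
      obtain ⟨z, hz, hz'⟩ := this
      exact ⟨z, fun _ => ⟨hz, hz'⟩⟩
    · exact ⟨0, fun h' => absurd h' h⟩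
  choose f hf using hex
  have hmem : ∀ g ∈ (A.image fun p : C2 => W • p) ×ˢ (A.image fun p : C2 => W • p),
      f g ∈ S ∧ ‖cDelta (W⁻¹ • g.1) (W⁻¹ • g.2) - f g‖ ≤ δ := by
    intro g hg
    apply hf
    rw [Finset.mem_product, Finset.mem_image, Finset.mem_image] at hg
    obtain ⟨⟨p, hp, hp'⟩, q, hq, hq'⟩ := hg
    rw [← hp', ← hq', inv_smul_smul₀ hW0.ne', inv_smul_smul₀ hW0.ne']
    exact ⟨p, q, ⟨p, hAE hp, mem_closedBall_self hδ.le⟩, ⟨q, hAE hq, mem_closedBall_self hδ.le⟩, rfl⟩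
  have hfin := hsc (A.image fun p : C2 => W • p) W hW480 (by
      intro p hp q hq hpq
      rw [Finset.mem_image] at hp hq
      obtain ⟨p, hp, rfl⟩ := hp
      obtain ⟨q, hq, rfl⟩ := hq
      have hne : p ≠ q := fun h => hpq (by rw [h])
      have h1 := hsep p hp q hq hne
      rw [← smul_sub, norm_smul, Real.norm_of_nonneg hW0.le]
      calc (1:ℝ) = W * (r / 2) := by rw [hW]; field_simp
        _ ≤ _ := by gcongr) (by
      intro p hp
      rw [Finset.mem_image] at hp
      obtain ⟨p, hp, rfl⟩ := hp
      have h1 := hE p (hAE hp) (mem_closedBall_self hδ.le)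
      rw [mem_closedBall_zero_iff] at h1
      rw [norm_smul, Real.norm_of_nonneg hW0.le]
      nlinarith) (by
      rw [hcardA]
      refine le_trans (le_of_eq ?_) hAc2
      rw [← hr4, hW]
      field_simp
      norm_num) S f (fun g hg => (hmem g hg).1) (by
      intro g hg h hh hgh
      have h1 := (hmem g hg).2
      have h2 := (hmem h hh).2
      rw [hgh] at h1
      rw [cDelta_smul] at h1 h2
      have h3 : ‖((W⁻¹ : ℝ) : ℂ) ^ 2 * (cDelta h.1 h.2 - cDelta g.1 g.2)‖ ≤ 2 * δ := by
        have e : ((W⁻¹ : ℝ) : ℂ) ^ 2 * (cDelta h.1 h.2 - cDelta g.1 g.2) =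
          (((W⁻¹ : ℝ) : ℂ) ^ 2 * cDelta h.1 h.2 - f h) -
            (((W⁻¹ : ℝ) : ℂ) ^ 2 * cDelta g.1 g.2 - f h) := by ring
        rw [e]
        exact (norm_sub_le _ _).trans (by linarith)
      rw [norm_mul, norm_pow, Complex.norm_real, Real.norm_of_nonneg (by positivity)] at h3
      have e2 : W⁻¹ ^ 2 = r ^ 2 / 4 := by rw [hW]; field_simp; norm_num
      rw [e2] at h3
      have hr2 : 0 < r ^ 2 := by positivity
      apply le_of_mul_le_mul_left _ hr2
      linarith)
  refine le_trans ?_ hfin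
  apply mul_le_mul_of_nonneg_left _ hc.le
  have h1 : r⁻¹ ≤ W := by
    rw [hW, inv_eq_one_div]; gcongr; norm_num
  have h2 : r⁻¹ ^ (4 - η) ≤ W ^ (4 - η) := rpow_le_rpow (by positivity) h1 (by linarith)
  refine le_trans ?_ h2
  rw [hr, ← rpow_neg hδ.le, ← rpow_mul hδ.le]
  apply rpow_le_rpow_of_exponent_ge hδ hδ1.le
  nlinarith

end Aux

/-- Corollary 1.3 / Theorem 5.1 of the paper: a discretized Falconer-type
distance estimate in `ℂ²`. -/
theorem statement3 (s ε : ℝ) (hs₁ : 1 < s) (hs₂ : s < 2) (hε : 0 < ε) :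
    ∃ c δ₀ : ℝ, 0 < c ∧ 0 < δ₀ ∧
      ∀ δ : ℝ, 0 < δ → δ < δ₀ →
      ∀ N : ℝ, 1 ≤ N →
      ∀ E : Finset C2,
        -- `E` is a set of pairwise disjoint `δ`-balls contained in `B_{ℂ²}(0,1)`
        (∀ x ∈ E, closedBall x δ ⊆ closedBall (0 : C2) 1) →
        (∀ x ∈ E, ∀ y ∈ E, x ≠ y → Disjoint (closedBall x δ) (closedBall y δ)) →
        -- with `(1/2) N δ^{-s} ≤ |E| ≤ 2 N δ^{-s}`
        (1 / 2 * N * δ ^ (-s) ≤ (E.card : ℝ)) → ((E.card : ℝ) ≤ 2 * N * δ ^ (-s)) →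
        -- and at most `N` of the `δ`-balls in each ball of radius `δ^{s/4}`
        (∀ z : C2,
          ((E.filter fun x => closedBall x δ ⊆ closedBall z (δ ^ (s / 4))).card : ℝ) ≤ N) →
        -- then any covering of `Δ(E)` by `δ`-balls uses at least `c δ^{-s+ε}` balls
        ∀ S : Finset ℂ, diffSet E δ ⊆ (⋃ z ∈ S, closedBall z δ) →
          c * δ ^ (-s + ε) ≤ (S.card : ℝ) := by
  obtain ⟨c, δ₀, hc, hδ₀, h⟩ := Aux.final s ε hs₁ hs₂ hε
  refine ⟨c, δ₀, hc, hδ₀, ?_⟩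
  intro δ hδ hδ' N hN E hE _ hcard _ hball S hS
  exact h δ hδ hδ' N hN E hE hcard hball S hS
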